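/- Ballot lower bound in the diffusive regime: fix M > 0. There exists c > 0 such that for all N ∈ ℕ and x, y ∈ [0, M·N^{1/2}], the random walk bridge from x to y on ⟦0,N⟧ satisfies P(X(k) ≥ 0 for k = 1,...,N-1) ≥ c·min(1, xy/N). -/

import Mathlib

open MeasureTheory Real
open scoped ENNReal

noncomputable section

/-- The full trajectory over `⟦0, n+1⟧` of a bridge with boundary values `u, v`
and interior values `q`. -/
def pathOf (u v : ℝ) (n : ℕ) (q : Fin n → ℝ) : ℕ → ℝ :=
  fun t => if h : 1 ≤ t ∧ t ≤ n then q ⟨t - 1, by omega⟩ else if t = 0 then u else v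

/-- Unnormalized density of a random walk bridge on `⟦0, n+1⟧` from `u` to `v`,
with increment Hamiltonian `H`: the product of `exp(-H(increment))` over all steps. -/
def bridgeDensity (H : ℝ → ℝ) (u v : ℝ) (n : ℕ) (q : Fin n → ℝ) : ℝ :=
  ∏ j ∈ Finset.range (n + 1),
    Real.exp (-(H (pathOf u v n q (j + 1) - pathOf u v n q j)))

/-- The (unnormalized) law of the interior points of a random walk bridge. -/
def bridgeMeasure (H : ℝ → ℝ) (u v : ℝ) (n : ℕ) : Measure (Fin n → ℝ) :=
  volume.withDensity fun q => ENNReal.ofReal (bridgeDensity H u v n q)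

open scoped Classical in
/-- The (unnormalized) law of a random walk bridge on `⟦0, n+1⟧` from `u` to `v`
constrained to stay above the floor in the interior, with area tilt
`exp(-c · Σ_j (X(j) - floor(j)))`. -/
def tiltedMeasure (H : ℝ → ℝ) (u v : ℝ) (n : ℕ) (c : ℝ) (floor : ℕ → ℝ) :
    Measure (Fin n → ℝ) :=
  volume.withDensity fun q =>
    ENNReal.ofReal (bridgeDensity H u v n q
      * Real.exp (-(c * ∑ j ∈ Finset.range (n + 1), (pathOf u v n q j - floor j)))
      * if ∀ t, 1 ≤ t → t ≤ n → floor t ≤ pathOf u v n q t then 1 else 0)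

/-- Probability of an event under the normalization of a finite measure. -/
def probOf {α : Type*} [MeasurableSpace α] (μ : Measure α) (E : Set α) : ℝ≥0∞ :=
  μ E / μ Set.univ

/-- The normalized (probability) version of a measure. -/
def normalizeMeasure {α : Type*} [MeasurableSpace α] (μ : Measure α) : Measure α :=
  (μ Set.univ)⁻¹ • μ

/-- Fluctuation scale `H_λ = λ^{-1/3} N^{1/3}`. -/
def Hlam (lam N : ℝ) : ℝ := lam ^ (-(1 : ℝ) / 3) * N ^ ((1 : ℝ) / 3)

/-- Assumptions on the random walk Hamiltonian: convexity (log-concavity of the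
increment density), zero mean, positive finite variance, and finite exponential
moments near zero. -/
structure RWAssumptions (H : ℝ → ℝ) : Prop where
  convex : ConvexOn ℝ Set.univ H
  integrable_exp : Integrable fun x : ℝ => Real.exp (-(H x))
  norm_pos : 0 < ∫ x : ℝ, Real.exp (-(H x))
  mean_zero : (∫ x : ℝ, x * Real.exp (-(H x))) = 0
  integrable_sq : Integrable fun x : ℝ => x ^ 2 * Real.exp (-(H x))
  var_pos : 0 < ∫ x : ℝ, x ^ 2 * Real.exp (-(H x))
  mgf : ∃ t₀ > 0, ∀ t : ℝ, |t| ≤ t₀ →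
    Integrable fun x : ℝ => Real.exp (t * x) * Real.exp (-(H x))

end

/-- The kernel density of a walk with step density `f` making `n + 1` steps from `x` to `y`,
each of the `n` intermediate positions being weighted by `g`. -/
noncomputable def bridgeKernel (f g : ℝ → ℝ≥0∞) : ℕ → ℝ → ℝ → ℝ≥0∞
  | 0, x, y => f (y - x)
  | n + 1, x, y => ∫⁻ z, f (z - x) * (g z * bridgeKernel f g n z y)

section Kernel

variable {f g : ℝ → ℝ≥0∞}

theorem measurable_bridgeKernel (hf : Measurable f) (hg : Measurable g) (n : ℕ) :
    Measurable fun p : ℝ × ℝ => bridgeKernel f g n p.1 p.2 := by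
  induction n with
  | zero => exact hf.comp (measurable_snd.sub measurable_fst)
  | succ n ih =>
    refine Measurable.lintegral_prod_right'
      (f := fun q : (ℝ × ℝ) × ℝ => f (q.2 - q.1.1) * (g q.2 * bridgeKernel f g n q.2 q.1.2)) ?_
    refine (hf.comp (by fun_prop)).mul ((hg.comp measurable_snd).mul ?_)
    exact ih.comp (f := fun q : (ℝ × ℝ) × ℝ => (q.2, q.1.2)) (by fun_prop)

theorem measurable_bridgeKernel_left (hf : Measurable f) (hg : Measurable g) (n : ℕ) (y : ℝ) :
    Measurable fun x => bridgeKernel f g n x y :=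
  (measurable_bridgeKernel hf hg n).comp (measurable_id.prodMk measurable_const)

theorem measurable_bridgeKernel_right (hf : Measurable f) (hg : Measurable g) (n : ℕ) (x : ℝ) :
    Measurable fun y => bridgeKernel f g n x y :=
  (measurable_bridgeKernel hf hg n).comp (measurable_const.prodMk measurable_id)

theorem lintegral_bridgeKernel_zero (hf : Measurable f) {w : ℝ → ℝ≥0∞} (hw : Measurable w)
    (x : ℝ) :
    ∫⁻ y, bridgeKernel f g 0 x y * w y = ∫⁻ t, w (x + t) ∂(volume.withDensity f) := by
  have hw' : Measurable fun t => w (x + t) := hw.comp (measurable_const_add x)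
  rw [lintegral_withDensity_eq_lintegral_mul _ hf hw', ← lintegral_add_left_eq_self _ x]
  simp [bridgeKernel]

theorem lintegral_bridgeKernel_succ' (hf : Measurable f) (hg : Measurable g)
    {w : ℝ → ℝ≥0∞} (hw : Measurable w) (n : ℕ) (x : ℝ) :
    ∫⁻ y, bridgeKernel f g (n + 1) x y * w y
      = ∫⁻ z, f (z - x) * (g z * ∫⁻ y, bridgeKernel f g n z y * w y) := by
  have hm : Measurable fun p : ℝ × ℝ =>
      f (p.2 - x) * (g p.2 * bridgeKernel f g n p.2 p.1) * w p.1 :=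
    ((hf.comp (by fun_prop)).mul ((hg.comp measurable_snd).mul
      ((measurable_bridgeKernel hf hg n).comp measurable_swap))).mul (hw.comp measurable_fst)
  calc ∫⁻ y, bridgeKernel f g (n + 1) x y * w y
      = ∫⁻ y, ∫⁻ z, f (z - x) * (g z * bridgeKernel f g n z y) * w y := by
        refine lintegral_congr fun y => ?_
        rw [lintegral_mul_const]
        · rfl
        · exact (hf.comp (by fun_prop)).mul (hg.mul (measurable_bridgeKernel_left hf hg n y))
    _ = ∫⁻ z, ∫⁻ y, f (z - x) * (g z * bridgeKernel f g n z y) * w y :=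
        lintegral_lintegral_swap hm.aemeasurable
    _ = _ := by
        refine lintegral_congr fun z => ?_
        have hk : Measurable fun y => bridgeKernel f g n z y * w y :=
          (measurable_bridgeKernel_right hf hg n z).mul hw
        rw [← lintegral_const_mul _ hk, ← lintegral_const_mul _ (hk.const_mul _)]
        simp only [mul_assoc]

theorem measurable_lintegral_bridgeKernel (hf : Measurable f) (hg : Measurable g)
    {w : ℝ → ℝ≥0∞} (hw : Measurable w) (n : ℕ) :
    Measurable fun x => ∫⁻ y, bridgeKernel f g n x y * w y :=
  Measurable.lintegral_prod_right'
    (f := fun p : ℝ × ℝ => bridgeKernel f g n p.1 p.2 * w p.2)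
    ((measurable_bridgeKernel hf hg n).mul (hw.comp measurable_snd))

theorem lintegral_bridgeKernel_succ (hf : Measurable f) (hg : Measurable g)
    {w : ℝ → ℝ≥0∞} (hw : Measurable w) (n : ℕ) (x : ℝ) :
    ∫⁻ y, bridgeKernel f g (n + 1) x y * w y
      = ∫⁻ t, g (x + t) * (∫⁻ y, bridgeKernel f g n (x + t) y * w y)
          ∂(volume.withDensity f) := by
  rw [lintegral_bridgeKernel_succ' hf hg hw]
  exact lintegral_bridgeKernel_zero (g := g) hf
    (hg.mul (measurable_lintegral_bridgeKernel hf hg hw n)) x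

/-- Chapman–Kolmogorov equation. -/
theorem bridgeKernel_add (hf : Measurable f) (hg : Measurable g) (m n : ℕ) (x y : ℝ) :
    bridgeKernel f g (m + n + 1) x y
      = ∫⁻ z, bridgeKernel f g m x z * (g z * bridgeKernel f g n z y) := by
  induction m generalizing x with
  | zero => rw [zero_add]; rfl
  | succ m ih =>
    have h := lintegral_bridgeKernel_succ' hf hg
      (hg.mul (measurable_bridgeKernel_left hf hg n y)) m x
    simp only [Pi.mul_apply, ← ih] at h
    rw [h, show m + 1 + n + 1 = (m + n + 1) + 1 by ring, bridgeKernel]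

theorem bridgeKernel_succ_last (hf : Measurable f) (hg : Measurable g) (n : ℕ) (x y : ℝ) :
    bridgeKernel f g (n + 1) x y
      = ∫⁻ z, bridgeKernel f g n x z * (g z * f (y - z)) :=
  bridgeKernel_add hf hg n 0 x y

theorem lintegral_bridgeKernel_add (hf : Measurable f) (hg : Measurable g)
    {w : ℝ → ℝ≥0∞} (hw : Measurable w) (m n : ℕ) (x : ℝ) :
    ∫⁻ y, bridgeKernel f g (m + n + 1) x y * w y
      = ∫⁻ z, bridgeKernel f g m x z * (g z * ∫⁻ y, bridgeKernel f g n z y * w y) := by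
  induction m generalizing x with
  | zero => rw [zero_add, lintegral_bridgeKernel_succ' hf hg hw]; rfl
  | succ m ih =>
    have h := lintegral_bridgeKernel_succ' hf hg
      (hg.mul (measurable_lintegral_bridgeKernel hf hg hw n)) m x
    simp only [Pi.mul_apply, ← ih] at h
    rw [h, show m + 1 + n + 1 = (m + n + 1) + 1 by ring, lintegral_bridgeKernel_succ' hf hg hw]

theorem bridgeKernel_reverse (hf : Measurable f) (hg : Measurable g) (n : ℕ) (x y : ℝ) :
    bridgeKernel (fun t => f (-t)) g n y x = bridgeKernel f g n x y := by
  induction n generalizing y with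
  | zero => simp [bridgeKernel]
  | succ n ih =>
    rw [bridgeKernel_succ_last hf hg, bridgeKernel]
    refine lintegral_congr fun z => ?_
    rw [ih, neg_sub]
    ring

theorem bridgeKernel_neg (n : ℕ) (x y : ℝ) :
    bridgeKernel (fun t => f (-t)) (fun t => g (-t)) n (-x) (-y) = bridgeKernel f g n x y := by
  induction n generalizing x with
  | zero => simp [bridgeKernel, add_comm, sub_eq_add_neg]
  | succ n ih =>
    simp only [bridgeKernel]
    rw [← lintegral_neg_eq_self]
    simp [ih, add_comm, sub_eq_add_neg]

/-- Chebyshev-type inequality for two pairs of functions ordered by likelihood ratio. -/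
theorem lintegral_mul_lintegral_le_of_likelihoodRatio {μ : Measure ℝ} [SFinite μ]
    {a b φ ψ : ℝ → ℝ≥0∞} (ha : Measurable a) (hb : Measurable b) (hφ : Measurable φ)
    (hψ : Measurable ψ) (hab : ∀ z w, z ≤ w → a z * b w ≤ a w * b z)
    (hφψ : ∀ z w, z ≤ w → φ z * ψ w ≤ φ w * ψ z) :
    (∫⁻ z, a z * ψ z ∂μ) * (∫⁻ z, b z * φ z ∂μ)
      ≤ (∫⁻ z, a z * φ z ∂μ) * (∫⁻ z, b z * ψ z ∂μ) := by
  have key : ∀ α β : ℝ → ℝ≥0∞, Measurable α → Measurable β →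
      (∫⁻ z, α z ∂μ) * (∫⁻ z, β z ∂μ) + (∫⁻ z, α z ∂μ) * (∫⁻ z, β z ∂μ)
        = ∫⁻ z, ∫⁻ w, (α z * β w + α w * β z) ∂μ ∂μ := by
    intro α β hα hβ
    have h1 : ∀ z, ∫⁻ w, (α z * β w + α w * β z) ∂μ
        = α z * (∫⁻ w, β w ∂μ) + (∫⁻ w, α w ∂μ) * β z := fun z => by
      rw [lintegral_add_left (hβ.const_mul _), lintegral_const_mul _ hβ,
        lintegral_mul_const _ hα]
    simp only [h1]
    rw [lintegral_add_left (hα.mul_const _), lintegral_mul_const _ hα, lintegral_const_mul _ hβ]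
  have h2 := key (fun z => a z * ψ z) (fun z => b z * φ z) (ha.mul hψ) (hb.mul hφ)
  have h3 := key (fun z => a z * φ z) (fun z => b z * ψ z) (ha.mul hφ) (hb.mul hψ)
  have hle : ∀ z w, a z * ψ z * (b w * φ w) + a w * ψ w * (b z * φ z)
      ≤ a z * φ z * (b w * ψ w) + a w * φ w * (b z * ψ z) := by
    have aux : ∀ z w, z ≤ w → a z * ψ z * (b w * φ w) + a w * ψ w * (b z * φ z)
      ≤ a z * φ z * (b w * ψ w) + a w * φ w * (b z * ψ z) := by
      intro z w hzw
      obtain ⟨d, hd⟩ := exists_add_of_le (hab z w hzw)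
      calc _ = a z * b w * (φ w * ψ z) + a w * b z * (φ z * ψ w) := by ring
        _ = a z * b w * (φ z * ψ w + φ w * ψ z) + d * (φ z * ψ w) := by rw [hd]; ring
        _ ≤ a z * b w * (φ z * ψ w + φ w * ψ z) + d * (φ w * ψ z) :=
          add_le_add le_rfl (mul_le_mul' le_rfl (hφψ z w hzw))
        _ = a z * b w * (φ z * ψ w) + a w * b z * (φ w * ψ z) := by rw [hd]; ring
        _ = _ := by ring
    intro z w
    rcases le_total z w with h | h
    · exact aux z w h
    · simpa only [add_comm] using aux w z h
  have h4 : ∀ A : ℝ≥0∞, A + A = 2 * A := fun A => (two_mul A).symm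
  rw [h4] at h2 h3
  refine (ENNReal.mul_le_mul_iff_right two_ne_zero ENNReal.ofNat_ne_top).1 ?_
  rw [h2, h3]
  exact lintegral_mono fun z => lintegral_mono fun w => hle z w

variable (hf : Measurable f) (hfTP : ∀ s t z w : ℝ, s ≤ t → z ≤ w →
  f (t - z) * f (s - w) ≤ f (t - w) * f (s - z))
include hf hfTP

theorem bridgeKernel_one_totallyPositive (n : ℕ) {z z' w y : ℝ} (hz : z ≤ z') (hwy : w ≤ y) :
    bridgeKernel f 1 n z y * bridgeKernel f 1 n z' w
      ≤ bridgeKernel f 1 n z' y * bridgeKernel f 1 n z w := by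
  induction n generalizing z z' with
  | zero => exact hfTP w y z z' hwy hz
  | succ n ih =>
    have h := lintegral_mul_lintegral_le_of_likelihoodRatio (μ := volume)
      (a := fun u => f (u - z')) (b := fun u => f (u - z))
      (φ := fun u => bridgeKernel f 1 n u y) (ψ := fun u => bridgeKernel f 1 n u w)
      (hf.comp (by fun_prop)) (hf.comp (by fun_prop))
      (measurable_bridgeKernel_left hf measurable_one n y)
      (measurable_bridgeKernel_left hf measurable_one n w)
      (fun u v huv => (mul_comm _ _).trans_le (hfTP u v z z' huv hz))
      (fun u v huv => ih huv)
    simp only [bridgeKernel, Pi.one_apply, one_mul]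
    rw [mul_comm]
    exact h

theorem bridgeKernel_ratio_monotone (hg : Measurable g) (hgm : Monotone g)
    (n : ℕ) (x : ℝ) {y y' : ℝ} (hy : y ≤ y') :
    bridgeKernel f g n x y * bridgeKernel f 1 n x y'
      ≤ bridgeKernel f g n x y' * bridgeKernel f 1 n x y := by
  induction n generalizing y y' with
  | zero => exact (mul_comm _ _).le
  | succ n ih =>
    have h := lintegral_mul_lintegral_le_of_likelihoodRatio (μ := volume)
      (a := fun u => bridgeKernel f g n x u * g u) (b := fun u => bridgeKernel f 1 n x u)
      (φ := fun u => f (y' - u)) (ψ := fun u => f (y - u))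
      ((measurable_bridgeKernel_right hf hg n x).mul hg)
      (measurable_bridgeKernel_right hf measurable_one n x)
      (hf.comp (by fun_prop)) (hf.comp (by fun_prop))
      (fun u v huv => by
        calc _ = bridgeKernel f g n x u * bridgeKernel f 1 n x v * g u := by ring
          _ ≤ bridgeKernel f g n x v * bridgeKernel f 1 n x u * g v :=
            mul_le_mul' (ih huv) (hgm huv)
          _ = _ := by ring)
      (fun u v huv => hfTP y y' u v hy huv)
    simp only [bridgeKernel_succ_last hf hg, bridgeKernel_succ_last hf measurable_one,
      Pi.one_apply, one_mul]
    simpa only [mul_assoc] using h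

end Kernel

/-- The step density `exp (-H)` as an extended nonnegative function. -/
noncomputable def stepDensity (H : ℝ → ℝ) (t : ℝ) : ℝ≥0∞ := ENNReal.ofReal (Real.exp (-(H t)))

section Path

variable {H : ℝ → ℝ} {g : ℝ → ℝ≥0∞}

theorem measurable_stepDensity (hH : Measurable H) : Measurable (stepDensity H) := by
  unfold stepDensity; fun_prop

theorem pathOf_cons_succ (u v z : ℝ) (n : ℕ) (q : Fin n → ℝ) (t : ℕ) :
    pathOf u v (n + 1) (Fin.cons z q : Fin (n + 1) → ℝ) (t + 1) = pathOf z v n q t := by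
  rcases t with _ | t
  · simp [pathOf]
  · by_cases h : t + 1 ≤ n
    · unfold pathOf
      rw [dif_pos (by omega), dif_pos (by omega)]
      rfl
    · simp [pathOf, h]

theorem bridgeDensity_cons (u v z : ℝ) (n : ℕ) (q : Fin n → ℝ) :
    bridgeDensity H u v (n + 1) (Fin.cons z q : Fin (n + 1) → ℝ)
      = Real.exp (-(H (z - u))) * bridgeDensity H z v n q := by
  unfold bridgeDensity
  rw [Finset.prod_range_succ', mul_comm]
  simp only [pathOf_cons_succ]
  simp [pathOf]

theorem measurable_pathOf (u v : ℝ) (n t : ℕ) :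
    Measurable fun q : Fin n → ℝ => pathOf u v n q t := by
  unfold pathOf
  split_ifs <;> fun_prop

theorem measurable_bridgeDensity (hH : Measurable H) (u v : ℝ) (n : ℕ) :
    Measurable fun q : Fin n → ℝ => bridgeDensity H u v n q := by
  unfold bridgeDensity
  refine Finset.measurable_prod _ fun j _ => ?_
  have h1 := measurable_pathOf u v n (j + 1)
  have h2 := measurable_pathOf u v n j
  exact (hH.comp (h1.sub h2)).neg.exp

theorem lintegral_bridgeDensity (hH : Measurable H) (hg : Measurable g) (n : ℕ) (u v : ℝ) :
    ∫⁻ q : Fin n → ℝ, (∏ i, g (q i)) * ENNReal.ofReal (bridgeDensity H u v n q)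
      = bridgeKernel (stepDensity H) g n u v := by
  induction n generalizing u with
  | zero =>
    rw [volume_pi, Measure.pi_of_empty _ (fun i => i.elim0), lintegral_dirac]
    simp [bridgeKernel, bridgeDensity, pathOf, stepDensity]
  | succ n ih =>
    have hm : Measurable fun q : Fin (n + 1) → ℝ =>
        (∏ i, g (q i)) * ENNReal.ofReal (bridgeDensity H u v (n + 1) q) :=
      (Finset.measurable_prod _ fun i _ => hg.comp (measurable_pi_apply i)).mul
        (measurable_bridgeDensity hH u v (n + 1)).ennreal_ofReal
    have hmn : ∀ z, Measurable fun q : Fin n → ℝ =>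
        (∏ i, g (q i)) * ENNReal.ofReal (bridgeDensity H z v n q) := fun z =>
      (Finset.measurable_prod _ fun i _ => hg.comp (measurable_pi_apply i)).mul
        (measurable_bridgeDensity hH z v n).ennreal_ofReal
    have hmp := (volume_preserving_piFinSuccAbove (fun _ : Fin (n + 1) => ℝ) 0).symm
    rw [← hmp.lintegral_comp_emb (MeasurableEquiv.measurableEmbedding _), Measure.volume_eq_prod,
      lintegral_prod _ (by exact (hm.comp (MeasurableEquiv.measurable _)).aemeasurable),
      bridgeKernel]
    refine lintegral_congr fun z => ?_
    rw [← ih, ← lintegral_const_mul _ (hmn z), ← lintegral_const_mul _ ((hmn z).const_mul _)]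
    refine lintegral_congr fun q => ?_
    have hcons : (MeasurableEquiv.piFinSuccAbove (fun _ : Fin (n + 1) => ℝ) 0).symm (z, q)
        = (Fin.cons z q : Fin (n + 1) → ℝ) := by
      simp [MeasurableEquiv.piFinSuccAbove, Fin.insertNthEquiv]
    rw [hcons, bridgeDensity_cons, Fin.prod_univ_succ, ENNReal.ofReal_mul (Real.exp_pos _).le]
    simp only [Fin.cons_zero, Fin.cons_succ, stepDensity]
    ring

theorem bridgeMeasure_univ (hH : Measurable H) (u v : ℝ) (n : ℕ) :
    bridgeMeasure H u v n Set.univ = bridgeKernel (stepDensity H) 1 n u v := by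
  rw [bridgeMeasure, withDensity_apply _ MeasurableSet.univ, Measure.restrict_univ,
    ← lintegral_bridgeDensity hH measurable_one]
  simp

/-- The indicator of the nonnegative half-line. -/
noncomputable def nonnegIndicator : ℝ → ℝ≥0∞ := (Set.Ici 0).indicator 1

theorem measurable_nonnegIndicator : Measurable nonnegIndicator :=
  measurable_one.indicator measurableSet_Ici

theorem nonnegIndicator_of_nonneg {x : ℝ} (hx : 0 ≤ x) : nonnegIndicator x = 1 :=
  Set.indicator_of_mem (Set.mem_Ici.2 hx) _

theorem nonnegIndicator_of_neg {x : ℝ} (hx : x < 0) : nonnegIndicator x = 0 :=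
  Set.indicator_of_notMem (by simpa using hx) _

theorem nonnegIndicator_le_one (x : ℝ) : nonnegIndicator x ≤ 1 :=
  Set.indicator_le_self' (fun _ _ => zero_le) x

theorem nonnegIndicator_monotone : Monotone nonnegIndicator := by
  intro x y hxy
  rcases lt_or_ge x 0 with h | h
  · rw [nonnegIndicator_of_neg h]; exact zero_le
  · rw [nonnegIndicator_of_nonneg h, nonnegIndicator_of_nonneg (h.trans hxy)]

theorem bridgeMeasure_nonneg (hH : Measurable H) (u v : ℝ) (n : ℕ) :
    bridgeMeasure H u v n {q | ∀ k, 1 ≤ k → k ≤ n → 0 ≤ pathOf u v n q k}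
      = bridgeKernel (stepDensity H) nonnegIndicator n u v := by
  have hset : {q : Fin n → ℝ | ∀ k, 1 ≤ k → k ≤ n → 0 ≤ pathOf u v n q k}
      = {q | ∀ i, 0 ≤ q i} := by
    ext q
    constructor
    · intro h i
      have := h (i + 1) (by omega) (by omega)
      simpa [pathOf, Nat.succ_le_of_lt i.2] using this
    · intro h k h1 h2
      simpa [pathOf, h1, h2] using h ⟨k - 1, by omega⟩
  have hms : MeasurableSet {q : Fin n → ℝ | ∀ i, 0 ≤ q i} := by
    rw [Set.ofPred_forall]
    exact MeasurableSet.iInter fun i => measurableSet_le measurable_const (measurable_pi_apply i)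
  rw [hset, bridgeMeasure, withDensity_apply _ hms, ← lintegral_indicator hms,
    ← lintegral_bridgeDensity hH measurable_nonnegIndicator]
  refine lintegral_congr fun q => ?_
  by_cases hq : ∀ i, 0 ≤ q i
  · rw [Set.indicator_of_mem (by exact hq),
      Finset.prod_eq_one fun i _ => nonnegIndicator_of_nonneg (hq i), one_mul]
  · rw [Set.indicator_of_notMem (by exact hq)]
    push Not at hq
    obtain ⟨i, hi⟩ := hq
    rw [Finset.prod_eq_zero (Finset.mem_univ i) (nonnegIndicator_of_neg hi), zero_mul]

theorem bridgeKernel_stepDensity_add_const (hH : Measurable H) (hg : Measurable g) (c : ℝ)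
    (n : ℕ) (u v : ℝ) :
    bridgeKernel (stepDensity fun t => H t + c) g n u v
      = ENNReal.ofReal (Real.exp (-c)) ^ (n + 1) * bridgeKernel (stepDensity H) g n u v := by
  have hs : ∀ t, stepDensity (fun t => H t + c) t
      = ENNReal.ofReal (Real.exp (-c)) * stepDensity H t := fun t => by
    rw [stepDensity, stepDensity, ← ENNReal.ofReal_mul (Real.exp_pos _).le, ← Real.exp_add]
    congr 2; ring
  induction n generalizing u with
  | zero => simp [bridgeKernel, hs]
  | succ n ih =>
    have hm : Measurable fun z =>
        stepDensity H (z - u) * (g z * bridgeKernel (stepDensity H) g n z v) :=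
      ((measurable_stepDensity hH).comp (by fun_prop)).mul
        (hg.mul (measurable_bridgeKernel_left (measurable_stepDensity hH) hg n v))
    simp only [bridgeKernel]
    rw [← lintegral_const_mul _ hm]
    refine lintegral_congr fun z => ?_
    rw [ih, hs]
    ring

end Path

namespace RWAssumptions

variable {H : ℝ → ℝ}

theorem continuous (hH : RWAssumptions H) : Continuous H :=
  continuousOn_univ.1 (hH.convex.continuousOn isOpen_univ)

theorem measurable (hH : RWAssumptions H) : Measurable H := hH.continuous.measurable

theorem measurable_stepDensity (hH : RWAssumptions H) : Measurable (stepDensity H) :=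
  _root_.measurable_stepDensity hH.measurable

theorem reflect (hH : RWAssumptions H) : RWAssumptions fun t => H (-t) where
  convex := by
    have := hH.convex.comp_linearMap (-LinearMap.id : ℝ →ₗ[ℝ] ℝ)
    simpa [Function.comp_def] using this
  integrable_exp := hH.integrable_exp.comp_neg
  norm_pos := by
    rw [integral_neg_eq_self (fun t => Real.exp (-(H t)))]
    exact hH.norm_pos
  mean_zero := by
    have := integral_neg_eq_self (fun t => t * Real.exp (-(H t))) volume
    simp only [neg_mul, integral_neg, hH.mean_zero] at this
    simpa using this
  integrable_sq := by simpa using hH.integrable_sq.comp_neg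
  var_pos := by
    have := integral_neg_eq_self (fun t => t ^ 2 * Real.exp (-(H t))) volume
    simp only [neg_sq] at this
    rw [this]
    exact hH.var_pos
  mgf := by
    obtain ⟨t₀, ht₀, h⟩ := hH.mgf
    refine ⟨t₀, ht₀, fun t ht => ?_⟩
    simpa using (h (-t) (by simpa using ht)).comp_neg

theorem add_const (hH : RWAssumptions H) (c : ℝ) : RWAssumptions fun t => H t + c := by
  have he : ∀ t, Real.exp (-(H t + c)) = Real.exp (-c) * Real.exp (-(H t)) := fun t => by
    rw [← Real.exp_add]; congr 1; ring
  have hc := Real.exp_pos (-c)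
  refine ⟨hH.convex.add_const c, ?_, ?_, ?_, ?_, ?_, ?_⟩
  · simpa only [he] using hH.integrable_exp.const_mul _
  · simp only [he, integral_const_mul]
    exact mul_pos hc hH.norm_pos
  · simp only [he, mul_left_comm _ (Real.exp (-c)), integral_const_mul, hH.mean_zero, mul_zero]
  · simpa only [he, mul_left_comm _ (Real.exp (-c))] using hH.integrable_sq.const_mul _
  · simp only [he, mul_left_comm _ (Real.exp (-c)), integral_const_mul]
    exact mul_pos hc hH.var_pos
  · obtain ⟨t₀, ht₀, h⟩ := hH.mgf
    refine ⟨t₀, ht₀, fun t ht => ?_⟩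
    simpa only [he, mul_left_comm _ (Real.exp (-c))] using (h t ht).const_mul _

theorem stepDensity_totallyPositive (hH : RWAssumptions H) (s t z w : ℝ) (hst : s ≤ t)
    (hzw : z ≤ w) :
    stepDensity H (t - z) * stepDensity H (s - w)
      ≤ stepDensity H (t - w) * stepDensity H (s - z) := by
  simp only [stepDensity, ← ENNReal.ofReal_mul (Real.exp_pos _).le, ← Real.exp_add]
  refine ENNReal.ofReal_le_ofReal (Real.exp_le_exp.2 ?_)
  suffices H (t - w) + H (s - z) ≤ H (t - z) + H (s - w) by linarith
  rcases (add_nonneg (sub_nonneg.2 hst) (sub_nonneg.2 hzw)).eq_or_lt with h0 | h0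
  · have h1 : s = t := by linarith
    have h2 : z = w := by linarith
    rw [h1, h2]
  · set D := (t - s) + (w - z)
    have ha : 0 ≤ (t - s) / D := div_nonneg (sub_nonneg.2 hst) h0.le
    have hb : 0 ≤ (w - z) / D := div_nonneg (sub_nonneg.2 hzw) h0.le
    have hab : (t - s) / D + (w - z) / D = 1 := by
      rw [← add_div]; exact div_self h0.ne'
    have h1 := hH.convex.2 (Set.mem_univ (t - z)) (Set.mem_univ (s - w)) ha hb hab
    have h2 := hH.convex.2 (Set.mem_univ (t - z)) (Set.mem_univ (s - w)) hb ha
      (by rw [add_comm, hab])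
    simp only [smul_eq_mul] at h1 h2
    have e1 : (t - s) / D * (t - z) + (w - z) / D * (s - w) = t - w := by
      field_simp; simp only [D]; ring
    have e2 : (w - z) / D * (t - z) + (t - s) / D * (s - w) = s - z := by
      field_simp; simp only [D]; ring
    rw [e1] at h1
    rw [e2] at h2
    have e3 : (w - z) / D = 1 - (t - s) / D := by linarith
    rw [e3] at h1 h2
    linarith

theorem exists_stepDensity_le (hH : RWAssumptions H) :
    ∃ B : ℝ, ∀ t, stepDensity H t ≤ ENNReal.ofReal B := by
  set Z := ∫ x : ℝ, Real.exp (-(H x)) with hZ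
  set c := Real.exp (-(H 0)) with hc
  have hc0 : 0 < c := Real.exp_pos _
  have key : ∀ x, c ≤ Real.exp (-(H x)) → |x| ≤ Z / c := by
    intro x hx
    have hle : H x ≤ H 0 := by simpa using Real.exp_le_exp.1 hx
    have hseg : ∀ s ∈ Set.uIcc 0 x, c ≤ Real.exp (-(H s)) := by
      intro s hs
      refine Real.exp_le_exp.2 (neg_le_neg ?_)
      rw [← segment_eq_uIcc] at hs
      exact (hH.convex.le_on_segment (Set.mem_univ _) (Set.mem_univ _) hs).trans
        (max_le le_rfl hle)
    have h1 : c * |x| ≤ ∫ s in Set.uIcc 0 x, Real.exp (-(H s)) := by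
      have h2 : ∫ s in Set.uIcc 0 x, c ≤ ∫ s in Set.uIcc 0 x, Real.exp (-(H s)) :=
        setIntegral_mono_on (by simp) hH.integrable_exp.integrableOn measurableSet_uIcc hseg
      simpa [measureReal_def, Real.volume_interval, mul_comm] using h2
    have h3 : ∫ s in Set.uIcc 0 x, Real.exp (-(H s)) ≤ Z :=
      setIntegral_le_integral hH.integrable_exp (Filter.Eventually.of_forall fun _ =>
        (Real.exp_pos _).le)
    rw [le_div_iff₀ hc0]
    linarith
  have hcont : Continuous fun x => Real.exp (-(H x)) := hH.continuous.neg.rexp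
  obtain ⟨B, hB⟩ := (isCompact_Icc (a := -(Z / c)) (b := Z / c)).bddAbove_image hcont.continuousOn
  refine ⟨max B c, fun t => ENNReal.ofReal_le_ofReal ?_⟩
  rcases le_total c (Real.exp (-(H t))) with h | h
  · exact (hB ⟨t, abs_le.1 (key t h), rfl⟩).trans (le_max_left _ _)
  · exact h.trans (le_max_right _ _)

theorem stepDensity_pos (H : ℝ → ℝ) (t : ℝ) : 0 < stepDensity H t :=
  ENNReal.ofReal_pos.2 (Real.exp_pos _)

end RWAssumptions

theorem bridgeKernel_one_pos {f : ℝ → ℝ≥0∞} (hf : Measurable f) (hpos : ∀ t, 0 < f t) (n : ℕ)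
    (x y : ℝ) : 0 < bridgeKernel f 1 n x y := by
  induction n generalizing x with
  | zero => exact hpos _
  | succ n ih =>
    have hm : Measurable fun z => f (z - x) * ((1 : ℝ → ℝ≥0∞) z * bridgeKernel f 1 n z y) :=
      (hf.comp (by fun_prop)).mul
        (measurable_one.mul (measurable_bridgeKernel_left hf measurable_one n y))
    rw [bridgeKernel, lintegral_pos_iff_support hm]
    have : Function.support (fun z => f (z - x) * ((1 : ℝ → ℝ≥0∞) z * bridgeKernel f 1 n z y))
        = Set.univ := by
      ext z
      simp [(hpos _).ne', (ih z).ne']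
    rw [this]
    simp

theorem bridgeKernel_one_le {f : ℝ → ℝ≥0∞} (hf1 : ∫⁻ t, f t = 1) {B : ℝ≥0∞}
    (hB : ∀ t, f t ≤ B) (hf : Measurable f) (n : ℕ) (x y : ℝ) : bridgeKernel f 1 n x y ≤ B := by
  induction n generalizing x with
  | zero => exact hB _
  | succ n ih =>
    calc bridgeKernel f 1 (n + 1) x y ≤ ∫⁻ z, f (z - x) * B := by
          rw [bridgeKernel]
          refine lintegral_mono fun z => mul_le_mul' le_rfl ?_
          rw [Pi.one_apply, one_mul]
          exact ih z
      _ = B := by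
          have hm : Measurable fun z => f (z - x) := hf.comp (by fun_prop)
          rw [lintegral_mul_const _ hm, lintegral_sub_right_eq_self, hf1, one_mul]

/-- The step distribution of the walk. -/
noncomputable def stepLaw (H : ℝ → ℝ) : Measure ℝ := volume.withDensity (stepDensity H)

namespace RWAssumptions

variable {H : ℝ → ℝ} (hH : RWAssumptions H)
include hH

theorem integrable_stepLaw_iff {φ : ℝ → ℝ} :
    Integrable φ (stepLaw H) ↔ Integrable fun t => φ t * Real.exp (-(H t)) := by
  rw [stepLaw, integrable_withDensity_iff_integrable_smul' hH.measurable_stepDensity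
    (Filter.Eventually.of_forall fun _ => ENNReal.ofReal_lt_top)]
  simp only [stepDensity, ENNReal.toReal_ofReal (Real.exp_pos _).le, smul_eq_mul, mul_comm]

theorem integral_stepLaw (φ : ℝ → ℝ) :
    ∫ t, φ t ∂(stepLaw H) = ∫ t, φ t * Real.exp (-(H t)) := by
  rw [stepLaw, integral_withDensity_eq_integral_toReal_smul hH.measurable_stepDensity
    (Filter.Eventually.of_forall fun _ => ENNReal.ofReal_lt_top)]
  simp only [stepDensity, ENNReal.toReal_ofReal (Real.exp_pos _).le, smul_eq_mul, mul_comm]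

theorem integral_id_stepLaw : ∫ t, t ∂(stepLaw H) = 0 := by
  rw [hH.integral_stepLaw]; exact hH.mean_zero

theorem exists_integrable_exp_stepLaw :
    ∃ t₀ > 0, ∀ t : ℝ, |t| ≤ t₀ → Integrable (fun x => Real.exp (t * x)) (stepLaw H) := by
  obtain ⟨t₀, ht₀, h⟩ := hH.mgf
  exact ⟨t₀, ht₀, fun t ht => hH.integrable_stepLaw_iff.2 (h t ht)⟩

theorem integrable_pow_stepLaw (n : ℕ) : Integrable (fun t => t ^ n) (stepLaw H) := by
  obtain ⟨t₀, ht₀, h⟩ := hH.exists_integrable_exp_stepLaw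
  exact ProbabilityTheory.integrable_pow_of_integrable_exp_mul (X := id) ht₀.ne'
    (h t₀ (abs_of_pos ht₀).le) (h (-t₀) (by rw [abs_neg, abs_of_pos ht₀])) n

theorem integrable_id_stepLaw : Integrable (fun t => t) (stepLaw H) := by
  simpa using hH.integrable_pow_stepLaw 1

theorem stepLaw_ne_zero {s : Set ℝ} (hs : volume s ≠ 0) : stepLaw H s ≠ 0 := by
  rw [stepLaw, Ne, withDensity_apply_eq_zero hH.measurable_stepDensity]
  have : {x | stepDensity H x ≠ 0} = Set.univ :=
    Set.eq_univ_of_forall fun x => (stepDensity_pos H x).ne'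
  rwa [this, Set.univ_inter]

theorem lintegral_stepDensity (hZ : ∫ x : ℝ, Real.exp (-(H x)) = 1) :
    ∫⁻ t, stepDensity H t = 1 := by
  simp only [stepDensity]
  rw [← ofReal_integral_eq_lintegral_ofReal hH.integrable_exp
    (Filter.Eventually.of_forall fun _ => (Real.exp_pos _).le), hZ, ENNReal.ofReal_one]

theorem isProbabilityMeasure_stepLaw (hZ : ∫ x : ℝ, Real.exp (-(H x)) = 1) :
    IsProbabilityMeasure (stepLaw H) := by
  constructor
  rw [stepLaw, withDensity_apply _ MeasurableSet.univ, Measure.restrict_univ,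
    hH.lintegral_stepDensity hZ]

end RWAssumptions

theorem ofReal_integral_le_lintegral_ofReal {α : Type*} [MeasurableSpace α] {μ : Measure α}
    (φ : α → ℝ) : ENNReal.ofReal (∫ a, φ a ∂μ) ≤ ∫⁻ a, ENNReal.ofReal (φ a) ∂μ := by
  by_cases h : Integrable φ μ
  · rw [integral_eq_lintegral_pos_part_sub_lintegral_neg_part h]
    exact (ENNReal.ofReal_le_ofReal (sub_le_self _ ENNReal.toReal_nonneg)).trans
      ENNReal.ofReal_toReal_le
  · simp [integral_undef h]

namespace RWAssumptions

variable {H : ℝ → ℝ} (hH : RWAssumptions H)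
include hH

theorem exists_undershoot_le (hZ : ∫ x : ℝ, Real.exp (-(H x)) = 1) :
    ∃ C : ℝ, 0 ≤ C ∧ ∀ x, 0 ≤ x →
      ∫⁻ t, ENNReal.ofReal (-x - t) ∂(stepLaw H) ≤ ENNReal.ofReal C * stepLaw H (Set.Iio (-x)) := by
  have hf := hH.measurable_stepDensity
  set A : ℝ → ℝ≥0∞ := fun x => ∫⁻ t, ENNReal.ofReal (-x - t) ∂(stepLaw H) with hA
  have hA' : ∀ x, A x = ∫⁻ s, stepDensity H (-x - s) * ENNReal.ofReal s := fun x => by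
    have hm : Measurable fun t : ℝ => ENNReal.ofReal (-x - t) := by fun_prop
    rw [hA, stepLaw]
    simp only
    rw [lintegral_withDensity_eq_lintegral_mul _ hf hm, ← lintegral_sub_left_eq_self _ (-x)]
    simp
  have hB' : ∀ x, stepLaw H (Set.Iio (-x))
      = ∫⁻ s, stepDensity H (-x - s) * (Set.Ioi (0 : ℝ)).indicator 1 s := fun x => by
    rw [stepLaw, withDensity_apply _ measurableSet_Iio, ← lintegral_indicator measurableSet_Iio,
      ← lintegral_sub_left_eq_self _ (-x)]
    refine lintegral_congr fun s => ?_
    by_cases hs : 0 < s <;> simp [Set.indicator, hs]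
  have hB0 : stepLaw H (Set.Iio (-0)) ≠ 0 := hH.stepLaw_ne_zero (by simp)
  have hA0 : A 0 ≠ ∞ := by
    have h1 : A 0 ≤ ∫⁻ t, ‖t‖ₑ ∂(stepLaw H) := lintegral_mono fun t => by
      rw [← ofReal_norm]
      exact ENNReal.ofReal_le_ofReal (by
        rw [Real.norm_eq_abs, neg_zero, zero_sub]; exact neg_le_abs t)
    exact (h1.trans_lt hH.integrable_id_stepLaw.2).ne
  have := hH.isProbabilityMeasure_stepLaw hZ
  have hB1 : stepLaw H (Set.Iio (-0)) ≠ ∞ := measure_ne_top _ _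
  refine ⟨(A 0 / stepLaw H (Set.Iio (-0))).toReal, ENNReal.toReal_nonneg, fun x hx => ?_⟩
  rw [ENNReal.ofReal_toReal (ENNReal.div_ne_top hA0 hB0), ← ENNReal.mul_div_right_comm,
    ENNReal.le_div_iff_mul_le (Or.inl hB0) (Or.inl hB1)]
  have h := lintegral_mul_lintegral_le_of_likelihoodRatio (μ := volume)
    (a := fun s => stepDensity H (-0 - s)) (b := fun s => stepDensity H (-x - s))
    (φ := fun s => ENNReal.ofReal s) (ψ := (Set.Ioi (0 : ℝ)).indicator 1)
    (hf.comp (by fun_prop)) (hf.comp (by fun_prop)) (by fun_prop)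
    (measurable_one.indicator measurableSet_Ioi)
    (fun z w hzw => hH.stepDensity_totallyPositive (-x) (-0) z w (by linarith) hzw)
    (fun z w hzw => by
      rcases le_or_gt z 0 with hz | hz
      · simp [ENNReal.ofReal_of_nonpos hz]
      · simp [hz, hz.trans_le hzw, ENNReal.ofReal_le_ofReal hzw])
  rw [← hA', ← hA', ← hB', ← hB'] at h
  rw [mul_comm]
  exact h

theorem exists_superharmonic (hZ : ∫ x : ℝ, Real.exp (-(H x)) = 1) :
    ∃ C : ℝ, 0 ≤ C ∧ ∀ x, 0 ≤ x →
      ∫⁻ t, nonnegIndicator (x + t) * ENNReal.ofReal (x + t + C) ∂(stepLaw H)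
        ≤ ENNReal.ofReal (x + C) := by
  have := hH.isProbabilityMeasure_stepLaw hZ
  obtain ⟨C, hC, h⟩ := hH.exists_undershoot_le hZ
  refine ⟨C, hC, fun x hx => ?_⟩
  have hid := hH.integrable_id_stepLaw
  have hi1 : Integrable (fun t => x + t + C) (stepLaw H) :=
    ((integrable_const x).add hid).add (integrable_const C)
  have hi2 : Integrable (fun t => max (-x - t) 0) (stepLaw H) :=
    ((integrable_const (-x)).sub hid).pos_part
  have hi3 : Integrable ((Set.Iio (-x)).indicator fun _ : ℝ => C) (stepLaw H) :=
    (integrable_const C).indicator measurableSet_Iio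
  have hi0 : Integrable (fun t => x + t) (stepLaw H) := (integrable_const x).add hid
  have hi12 : Integrable (fun t => x + t + C + max (-x - t) 0) (stepLaw H) := hi1.add hi2
  have hi : Integrable (fun t => x + t + C + max (-x - t) 0
      - (Set.Iio (-x)).indicator (fun _ => C) t) (stepLaw H) := hi12.sub hi3
  have hpt : ∀ t, nonnegIndicator (x + t) * ENNReal.ofReal (x + t + C)
      = ENNReal.ofReal (x + t + C + max (-x - t) 0 - (Set.Iio (-x)).indicator (fun _ => C) t)
      ∧ 0 ≤ x + t + C + max (-x - t) 0 - (Set.Iio (-x)).indicator (fun _ => C) t := by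
    intro t
    rcases lt_or_ge (x + t) 0 with ht | ht
    · rw [nonnegIndicator_of_neg ht, Set.indicator_of_mem (by simp; linarith),
        max_eq_left (by linarith)]
      ring_nf
      simp
    · rw [nonnegIndicator_of_nonneg ht, Set.indicator_of_notMem (by simp; linarith),
        max_eq_right (by linarith)]
      simp only [one_mul, add_zero, sub_zero, true_and]
      linarith
  simp only [fun t => (hpt t).1]
  rw [← ofReal_integral_eq_lintegral_ofReal hi
    (Filter.Eventually.of_forall fun t => (hpt t).2)]
  refine ENNReal.ofReal_le_ofReal ?_
  have e1 : ∫ t, (x + t + C) ∂(stepLaw H) = x + C := by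
    rw [integral_add hi0 (integrable_const C),
      integral_add (integrable_const x) hid, hH.integral_id_stepLaw]
    simp
  have e2 : ∫ t, max (-x - t) 0 ∂(stepLaw H) ≤ C * (stepLaw H).real (Set.Iio (-x)) := by
    rw [integral_eq_lintegral_of_nonneg_ae
      (Filter.Eventually.of_forall fun t => show (0 : ℝ) ≤ max (-x - t) 0 from
        le_max_right _ _) hi2.1]
    refine ENNReal.toReal_le_of_le_ofReal (by positivity) ?_
    rw [ENNReal.ofReal_mul hC, measureReal_def, ENNReal.ofReal_toReal (measure_ne_top _ _)]
    simpa using h x hx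
  have e3 : ∫ t, (Set.Iio (-x)).indicator (fun _ => C) t ∂(stepLaw H)
      = C * (stepLaw H).real (Set.Iio (-x)) := by
    rw [integral_indicator measurableSet_Iio, setIntegral_const, smul_eq_mul, mul_comm]
  rw [integral_sub hi12 hi3, integral_add hi1 hi2, e1, e3]
  linarith

theorem lintegral_superharmonic_le {C : ℝ} (hC : ∀ x, 0 ≤ x →
      ∫⁻ t, nonnegIndicator (x + t) * ENNReal.ofReal (x + t + C) ∂(stepLaw H)
        ≤ ENNReal.ofReal (x + C)) (n : ℕ) {x : ℝ} (hx : 0 ≤ x) :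
    ∫⁻ y, bridgeKernel (stepDensity H) nonnegIndicator n x y
        * (nonnegIndicator y * ENNReal.ofReal (y + C)) ≤ ENNReal.ofReal (x + C) := by
  have hf := hH.measurable_stepDensity
  have hg := measurable_nonnegIndicator
  have hw : Measurable fun y => nonnegIndicator y * ENNReal.ofReal (y + C) :=
    hg.mul (by fun_prop)
  induction n generalizing x with
  | zero => rw [lintegral_bridgeKernel_zero hf hw]; exact hC x hx
  | succ n ih =>
    rw [lintegral_bridgeKernel_succ hf hg hw]
    refine (lintegral_mono fun t => ?_).trans (hC x hx)
    rcases lt_or_ge (x + t) 0 with ht | ht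
    · simp [nonnegIndicator_of_neg ht]
    · exact mul_le_mul' le_rfl (ih ht)

theorem integral_cubic_stepLaw (hZ : ∫ x : ℝ, Real.exp (-(H x)) = 1) (a b c d e : ℝ) :
    Integrable (fun t => a + b * t + c * t ^ 2 + d * t ^ 3 + e * |t| ^ 3) (stepLaw H) ∧
    ∫ t, (a + b * t + c * t ^ 2 + d * t ^ 3 + e * |t| ^ 3) ∂(stepLaw H)
      = a + c * (∫ t, t ^ 2 ∂(stepLaw H)) + d * (∫ t, t ^ 3 ∂(stepLaw H))
        + e * (∫ t, |t| ^ 3 ∂(stepLaw H)) := by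
  have := hH.isProbabilityMeasure_stepLaw hZ
  have i0 : Integrable (fun _ : ℝ => a) (stepLaw H) := integrable_const a
  have i1 := hH.integrable_id_stepLaw.const_mul b
  have i2 := (hH.integrable_pow_stepLaw 2).const_mul c
  have i3 := (hH.integrable_pow_stepLaw 3).const_mul d
  have i4 : Integrable (fun t => e * |t| ^ 3) (stepLaw H) := by
    have := (hH.integrable_pow_stepLaw 3).abs.const_mul e
    simpa only [abs_pow] using this
  have i01 : Integrable (fun t => a + b * t) (stepLaw H) := i0.add i1
  have i02 : Integrable (fun t => a + b * t + c * t ^ 2) (stepLaw H) := i01.add i2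
  have i03 : Integrable (fun t => a + b * t + c * t ^ 2 + d * t ^ 3) (stepLaw H) := i02.add i3
  refine ⟨i03.add i4, ?_⟩
  rw [integral_add i03 i4, integral_add i02 i3, integral_add i01 i2, integral_add i0 i1]
  have e1 : ∫ t, b * t ∂(stepLaw H) = 0 := by
    rw [integral_const_mul, hH.integral_id_stepLaw, mul_zero]
  simp [integral_const_mul, e1]

/-- One step of the walk preserves the space-time cubic lower bound on survival probabilities. -/
theorem ofReal_cubic_le_lintegral (hZ : ∫ x : ℝ, Real.exp (-(H x)) = 1)
    {ε δ k x σ ρ : ℝ} (hε : 0 ≤ ε) (hδ : 0 ≤ δ) (hx : 0 ≤ x)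
    (hσ : σ = ∫ t, t ^ 2 ∂(stepLaw H)) (hρ : ρ = ∫ t, |t| ^ 3 ∂(stepLaw H))
    (hk0 : 0 ≤ k) (hk : 3 * ε * σ * k ≤ 1) {v : ℝ → ℝ≥0∞}
    (hv : ∀ z, 0 ≤ z →
      ENNReal.ofReal (δ * (z - ε * (z ^ 3 + 3 * σ * k * z + 2 * ρ * k))) ≤ v z) :
    ENNReal.ofReal (δ * (x - ε * (x ^ 3 + 3 * σ * (k + 1) * x + 2 * ρ * (k + 1))))
      ≤ ∫⁻ t, nonnegIndicator (x + t) * v (x + t) ∂(stepLaw H) := by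
  have hρ0 : 0 ≤ ρ := hρ ▸ integral_nonneg fun t => by positivity
  obtain ⟨-, hint⟩ := hH.integral_cubic_stepLaw hZ
    (δ * (x - ε * (x ^ 3 + 3 * σ * k * x + 2 * ρ * k)))
    (δ * (1 - 3 * ε * x ^ 2 - 3 * ε * σ * k)) (δ * (-3 * ε * x)) (-(δ * ε)) (-(δ * ε))
  have hμ : ∫ t, t ^ 3 ∂(stepLaw H) ≤ ρ := by
    rw [hρ]
    refine (le_abs_self _).trans (abs_integral_le_integral_abs.trans_eq ?_)
    simp only [abs_pow]
  calc ENNReal.ofReal (δ * (x - ε * (x ^ 3 + 3 * σ * (k + 1) * x + 2 * ρ * (k + 1))))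
      ≤ ENNReal.ofReal (∫ t, (δ * (x - ε * (x ^ 3 + 3 * σ * k * x + 2 * ρ * k))
          + δ * (1 - 3 * ε * x ^ 2 - 3 * ε * σ * k) * t + δ * (-3 * ε * x) * t ^ 2
          + -(δ * ε) * t ^ 3 + -(δ * ε) * |t| ^ 3) ∂(stepLaw H)) := by
        refine ENNReal.ofReal_le_ofReal ?_
        rw [hint, ← hσ, ← hρ]
        have := mul_le_mul_of_nonneg_left hμ (mul_nonneg hδ hε)
        linarith
    _ ≤ _ := ofReal_integral_le_lintegral_ofReal _
    _ ≤ _ := by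
        refine lintegral_mono fun t => ?_
        have hexp : δ * (x - ε * (x ^ 3 + 3 * σ * k * x + 2 * ρ * k))
          + δ * (1 - 3 * ε * x ^ 2 - 3 * ε * σ * k) * t + δ * (-3 * ε * x) * t ^ 2
          + -(δ * ε) * t ^ 3 + -(δ * ε) * |t| ^ 3
          = δ * ((x + t) - ε * ((x + t) ^ 3 + 3 * σ * k * (x + t) + 2 * ρ * k))
            - δ * (ε * |t| ^ 3) := by ring
        have ht3 : 0 ≤ ε * |t| ^ 3 := by positivity
        rcases lt_or_ge (x + t) 0 with ht | ht
        · refine (ENNReal.ofReal_of_nonpos ?_).trans_le zero_le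
          have h1 : |t| = -t := abs_of_neg (by linarith)
          have h2 : (-(x + t)) ^ 3 ≤ |t| ^ 3 := by
            rw [h1]; exact pow_le_pow_left₀ (by linarith) (by linarith) 3
          have h3 := mul_le_mul_of_nonneg_left h2 hε
          have h4 : 0 ≤ -(x + t) * (1 - 3 * ε * σ * k) :=
            mul_nonneg (by linarith) (by linarith)
          have h5 : 0 ≤ ε * (2 * ρ * k) := by positivity
          rw [hexp, ← mul_sub]
          refine mul_nonpos_of_nonneg_of_nonpos hδ ?_
          nlinarith
        · rw [nonnegIndicator_of_nonneg ht, one_mul]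
          refine (ENNReal.ofReal_le_ofReal ?_).trans (hv _ ht)
          rw [hexp]
          have := mul_nonneg hδ ht3
          linarith

end RWAssumptions

namespace RWAssumptions

variable {H : ℝ → ℝ} (hH : RWAssumptions H)
include hH

theorem ofReal_cubic_le_lintegral_bridgeKernel (hZ : ∫ x : ℝ, Real.exp (-(H x)) = 1)
    {ε σ ρ : ℝ} (hε : 0 ≤ ε) (hσ : σ = ∫ t, t ^ 2 ∂(stepLaw H))
    (hρ : ρ = ∫ t, |t| ^ 3 ∂(stepLaw H)) (n : ℕ) (hn : 3 * ε * σ * n ≤ 1) {x : ℝ} (hx : 0 ≤ x) :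
    ENNReal.ofReal (√ε * (x - ε * (x ^ 3 + 3 * σ * (n + 1) * x + 2 * ρ * (n + 1))))
      ≤ ∫⁻ y, bridgeKernel (stepDensity H) nonnegIndicator n x y * nonnegIndicator y := by
  have hf := hH.measurable_stepDensity
  have hg := measurable_nonnegIndicator
  have hσ0 : 0 ≤ σ := hσ ▸ integral_nonneg fun t => by positivity
  induction n generalizing x with
  | zero =>
    rw [lintegral_bridgeKernel_zero hf hg, ← stepLaw]
    have h := hH.ofReal_cubic_le_lintegral hZ (v := fun _ => 1) hε (Real.sqrt_nonneg ε) hx hσ hρ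
      le_rfl (by simp) (fun z hz => by
        rw [← ENNReal.ofReal_one]
        refine ENNReal.ofReal_le_ofReal ?_
        have h1 : √ε * (z - ε * (z ^ 3 + 3 * σ * 0 * z + 2 * ρ * 0))
            = √ε * z - (√ε * z) ^ 3 := by
          nth_rewrite 2 [← Real.mul_self_sqrt hε]; ring
        rw [h1]
        have h2 : 0 ≤ √ε * z := by positivity
        nlinarith [mul_nonneg h2 (sq_nonneg (√ε * z - 1)), sq_nonneg (√ε * z - 1)])
    simpa using h
  | succ n ih =>
    rw [lintegral_bridgeKernel_succ hf hg hg, ← stepLaw]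
    have hn' : 3 * ε * σ * (n + 1) ≤ 1 := by exact_mod_cast hn
    have h := hH.ofReal_cubic_le_lintegral hZ (k := n + 1) hε (Real.sqrt_nonneg ε) hx hσ hρ
      (by positivity) hn' (v := fun z => ∫⁻ y, bridgeKernel (stepDensity H) nonnegIndicator n z y
        * nonnegIndicator y) (fun z hz => ih (by
          have : 0 ≤ 3 * ε * σ := by positivity
          linarith) hz)
    simpa using h

theorem lintegral_bridgeKernel_succ_le (hZ : ∫ x : ℝ, Real.exp (-(H x)) = 1) (n : ℕ) (x : ℝ) :
    ∫⁻ y, bridgeKernel (stepDensity H) nonnegIndicator (n + 1) x y * nonnegIndicator y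
      ≤ ∫⁻ y, bridgeKernel (stepDensity H) nonnegIndicator n x y * nonnegIndicator y := by
  have hf := hH.measurable_stepDensity
  have hg := measurable_nonnegIndicator
  have := hH.isProbabilityMeasure_stepLaw hZ
  have h := lintegral_bridgeKernel_add hf hg hg n 0 x
  rw [add_zero] at h
  rw [h]
  refine lintegral_mono fun z => mul_le_mul' le_rfl (mul_le_of_le_one_right' ?_)
  rw [lintegral_bridgeKernel_zero hf hg]
  calc ∫⁻ t, nonnegIndicator (z + t) ∂(stepLaw H) ≤ ∫⁻ _, 1 ∂(stepLaw H) :=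
        lintegral_mono fun t => nonnegIndicator_le_one _
    _ = 1 := by simp

theorem exists_le_survival (hZ : ∫ x : ℝ, Real.exp (-(H x)) = 1) {M : ℝ} (hM : 0 < M) :
    ∃ c > 0, ∀ n N : ℕ, n + 1 ≤ N → ∀ x ∈ Set.Icc 0 (M * √N),
      ENNReal.ofReal (c * (x + 1) / √N)
        ≤ ∫⁻ y, bridgeKernel (stepDensity H) nonnegIndicator n x y * nonnegIndicator y := by
  have hf := hH.measurable_stepDensity
  have hg := measurable_nonnegIndicator
  have := hH.isProbabilityMeasure_stepLaw hZ
  obtain ⟨σ, hσ⟩ : ∃ σ, σ = ∫ t, t ^ 2 ∂(stepLaw H) := ⟨_, rfl⟩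
  obtain ⟨ρ, hρ⟩ : ∃ ρ, ρ = ∫ t, |t| ^ 3 ∂(stepLaw H) := ⟨_, rfl⟩
  have hσ0 : 0 ≤ σ := hσ ▸ integral_nonneg fun t => by positivity
  have hρ0 : 0 ≤ ρ := hρ ▸ integral_nonneg fun t => by positivity
  set D := 4 * ((M + 2) ^ 2 + 3 * σ + 2 * ρ) with hD
  have hD0 : 0 < D := by positivity
  set p := (stepLaw H).real (Set.Icc 1 2) with hp
  have hp0 : 0 < p := by
    rw [hp, measureReal_def]
    exact ENNReal.toReal_pos (hH.stepLaw_ne_zero (by simp)) (measure_ne_top _ _)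
  refine ⟨p * (√(1 / D) / 2), by positivity, fun n N hnN x hx => ?_⟩
  have hN : (0 : ℝ) < N := by exact_mod_cast (Nat.succ_pos n).trans_le hnN
  have hnN' : (n : ℝ) + 1 ≤ N := by exact_mod_cast hnN
  have hN1 : 1 ≤ √(N : ℝ) := by
    rw [Real.one_le_sqrt]; linarith [(Nat.cast_nonneg n : (0 : ℝ) ≤ n)]
  have key : ∀ z, 1 ≤ z → z ≤ (M + 2) * √N → ENNReal.ofReal (√(1 / D / N) * (z / 2))
      ≤ ∫⁻ y, bridgeKernel (stepDensity H) nonnegIndicator n z y * nonnegIndicator y := by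
    intro z hz1 hz2
    have hεN : 1 / D / N * N = 1 / D := by field_simp
    have hε0 : 0 < 1 / D / N := by positivity
    set ε := 1 / D / N with hε
    have hε1 : ε * (n + 1) ≤ 1 / D := by
      rw [← hεN]; exact mul_le_mul_of_nonneg_left hnN' hε0.le
    have hDD : 1 / D * ((M + 2) ^ 2 + 3 * σ + 2 * ρ) = 1 / 4 := by
      rw [hD]; field_simp
    have hD1 : 1 / D * (3 * σ) ≤ 1 / 4 := by
      have : 0 ≤ 1 / D * ((M + 2) ^ 2 + 2 * ρ) := by positivity
      linarith
    have hn0 : 0 ≤ 3 * ε * σ := by positivity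
    refine (ENNReal.ofReal_le_ofReal (mul_le_mul_of_nonneg_left ?_ (Real.sqrt_nonneg _))).trans
      (hH.ofReal_cubic_le_lintegral_bridgeKernel hZ hε0.le hσ hρ n ?_ (by linarith))
    · have h1 : ε * z ^ 2 ≤ 1 / D * (M + 2) ^ 2 := by
        have : z ^ 2 ≤ (M + 2) ^ 2 * N := by
          rw [← Real.sq_sqrt hN.le, ← mul_pow]
          exact pow_le_pow_left₀ (by linarith) hz2 2
        calc ε * z ^ 2 ≤ ε * ((M + 2) ^ 2 * N) := mul_le_mul_of_nonneg_left this hε0.le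
          _ = _ := by rw [← hεN]; ring
      have h2 := mul_le_mul_of_nonneg_right h1 (by linarith : (0 : ℝ) ≤ z)
      have h3 := mul_le_mul_of_nonneg_right hε1 (by positivity : (0 : ℝ) ≤ 3 * σ * z)
      have h4 := mul_le_mul_of_nonneg_right hε1 (by positivity : (0 : ℝ) ≤ 2 * ρ)
      have h5 : 1 / D * (2 * ρ) ≤ 1 / D * (2 * ρ) * z :=
        le_mul_of_one_le_right (by positivity) hz1
      have h6 : 1 / D * (M + 2) ^ 2 * z + 1 / D * (3 * σ * z) + 1 / D * (2 * ρ) * z = z / 4 := by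
        linear_combination z * hDD
      linarith
    · have := mul_le_mul_of_nonneg_right hε1 (by positivity : (0 : ℝ) ≤ 3 * σ)
      linarith
  refine le_trans ?_ (hH.lintegral_bridgeKernel_succ_le hZ n x)
  rw [lintegral_bridgeKernel_succ hf hg hg]
  calc ENNReal.ofReal (p * (√(1 / D) / 2) * (x + 1) / √N)
      = ENNReal.ofReal (√(1 / D / N) * ((x + 1) / 2)) * stepLaw H (Set.Icc 1 2) := by
        rw [← ENNReal.ofReal_toReal (measure_ne_top (stepLaw H) (Set.Icc 1 2)),
          ← measureReal_def, ← hp, ← ENNReal.ofReal_mul (by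
            have := hx.1; positivity), Real.sqrt_div (by positivity) (N : ℝ)]
        congr 1; ring
    _ = ∫⁻ _ in Set.Icc 1 2, ENNReal.ofReal (√(1 / D / N) * ((x + 1) / 2)) ∂(stepLaw H) := by
        rw [setLIntegral_const]
    _ ≤ ∫⁻ t in Set.Icc 1 2, nonnegIndicator (x + t)
          * (∫⁻ y, bridgeKernel (stepDensity H) nonnegIndicator n (x + t) y * nonnegIndicator y)
          ∂(stepLaw H) := by
        refine setLIntegral_mono' measurableSet_Icc fun t ht => ?_
        have h0 := hx.1
        have h1 := ht.1
        have h2 := ht.2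
        rw [nonnegIndicator_of_nonneg (by linarith), one_mul]
        refine le_trans (ENNReal.ofReal_le_ofReal ?_) (key (x + t) (by linarith) ?_)
        · gcongr
        · nlinarith [hx.2]
    _ ≤ _ := setLIntegral_le_lintegral _ _

theorem exists_le_survival_near (hZ : ∫ x : ℝ, Real.exp (-(H x)) = 1) {M : ℝ} (hM : 0 < M) :
    ∃ c > 0, ∃ K₀ : ℝ, ∀ K, K₀ ≤ K → ∀ n N : ℕ, n + 1 ≤ N → ∀ x ∈ Set.Icc 0 (M * √N),
      ENNReal.ofReal (c * (x + 1) / √N)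
        ≤ ∫⁻ y, bridgeKernel (stepDensity H) nonnegIndicator n x y
          * (Set.Icc 0 (K * √N)).indicator 1 y := by
  have hf := hH.measurable_stepDensity
  have hg := measurable_nonnegIndicator
  obtain ⟨c, hc, h⟩ := hH.exists_le_survival hZ hM
  obtain ⟨C, hC, hsup⟩ := hH.exists_superharmonic hZ
  refine ⟨c / 2, by positivity, 2 * (C + 1) / c, fun K hK n N hnN x hx => ?_⟩
  have hN : (0 : ℝ) < N := by exact_mod_cast (Nat.succ_pos n).trans_le hnN
  have hK0 : 0 < K := lt_of_lt_of_le (by positivity) hK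
  have hN0 : 0 < √(N : ℝ) := Real.sqrt_pos.2 hN
  set κ := K * √N with hκ
  have hκ0 : 0 < κ := by positivity
  set k := bridgeKernel (stepDensity H) nonnegIndicator n x with hk
  have hkm : Measurable k := measurable_bridgeKernel_right hf hg n x
  have hfar : ∫⁻ y, k y * (Set.Ioi κ).indicator 1 y ≤ ENNReal.ofReal ((x + C) / κ) := by
    rw [ENNReal.ofReal_div_of_pos hκ0, ENNReal.le_div_iff_mul_le
      (Or.inl (by simpa using hκ0)) (Or.inl ENNReal.ofReal_ne_top),
      ← lintegral_mul_const' _ _ ENNReal.ofReal_ne_top]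
    refine (lintegral_mono fun y => ?_).trans (hH.lintegral_superharmonic_le hsup n hx.1)
    rcases le_or_gt y κ with hy | hy
    · simp [hy]
    · rw [Set.indicator_of_mem (by exact hy), Pi.one_apply, mul_one,
        nonnegIndicator_of_nonneg (hκ0.trans hy).le, one_mul]
      exact mul_le_mul' le_rfl (ENNReal.ofReal_le_ofReal (by linarith))
  have hsplit : ∫⁻ y, k y * nonnegIndicator y
      ≤ (∫⁻ y, k y * (Set.Icc 0 κ).indicator 1 y) + ∫⁻ y, k y * (Set.Ioi κ).indicator 1 y := by
    have hkI : Measurable fun y => k y * (Set.Icc 0 κ).indicator 1 y :=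
      hkm.mul (measurable_one.indicator measurableSet_Icc)
    rw [← lintegral_add_left hkI]
    refine lintegral_mono fun y => ?_
    rw [← mul_add]
    refine mul_le_mul' le_rfl ?_
    rcases lt_or_ge y 0 with h0 | h0
    · simp [nonnegIndicator_of_neg h0]
    · rcases le_or_gt y κ with hy | hy
      · simp [nonnegIndicator_of_nonneg h0, h0, hy]
      · simp [nonnegIndicator_of_nonneg h0, hy]
  have hx0 := hx.1
  have hle : (x + C) / κ ≤ c / 2 * (x + 1) / √N := by
    rw [div_le_div_iff₀ hκ0 hN0]
    have h1 : 2 * (C + 1) ≤ K * c := by rwa [div_le_iff₀ hc] at hK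
    have h2 : x + C ≤ (C + 1) * (x + 1) := by nlinarith
    have h3 : (C + 1) * (x + 1) ≤ K * c / 2 * (x + 1) :=
      mul_le_mul_of_nonneg_right (by linarith) (by linarith)
    calc (x + C) * √N ≤ K * c / 2 * (x + 1) * √N :=
          mul_le_mul_of_nonneg_right (h2.trans h3) hN0.le
      _ = _ := by rw [hκ]; ring
  have htot := ((h n N hnN x hx).trans hsplit).trans
    (add_le_add le_rfl (hfar.trans (ENNReal.ofReal_le_ofReal hle)))
  have hadd : ENNReal.ofReal (c * (x + 1) / √N)
      = ENNReal.ofReal (c / 2 * (x + 1) / √N) + ENNReal.ofReal (c / 2 * (x + 1) / √N) := by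
    rw [← ENNReal.ofReal_add (by positivity) (by positivity)]
    congr 1; ring
  rw [hadd] at htot
  exact (ENNReal.add_le_add_iff_right ENNReal.ofReal_ne_top).1 htot

/-- The bridge kernel integrates to one over its endpoint. -/
theorem lintegral_bridgeKernel_one (hZ : ∫ x : ℝ, Real.exp (-(H x)) = 1) (n : ℕ) (x : ℝ) :
    ∫⁻ y, bridgeKernel (stepDensity H) 1 n x y = 1 := by
  have hf := hH.measurable_stepDensity
  have := hH.isProbabilityMeasure_stepLaw hZ
  suffices ∫⁻ y, bridgeKernel (stepDensity H) 1 n x y * (1 : ℝ → ℝ≥0∞) y = 1 by simpa using this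
  induction n generalizing x with
  | zero =>
    rw [lintegral_bridgeKernel_zero hf measurable_one]
    exact (lintegral_one (μ := stepLaw H)).trans measure_univ
  | succ n ih =>
    rw [lintegral_bridgeKernel_succ hf measurable_one measurable_one, ← stepLaw]
    simp only [ih, mul_one]
    exact (lintegral_one (μ := stepLaw H)).trans measure_univ

theorem lintegral_mul_bridgeKernel_le (hZ : ∫ x : ℝ, Real.exp (-(H x)) = 1) (n : ℕ) (x : ℝ)
    {s : Set ℝ} (hs : MeasurableSet s) {z : ℝ} (hz : ∀ w ∈ s, w ≤ z) :
    (∫⁻ y, bridgeKernel (stepDensity H) nonnegIndicator n x y * s.indicator 1 y)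
        * bridgeKernel (stepDensity H) 1 n x z
      ≤ bridgeKernel (stepDensity H) nonnegIndicator n x z := by
  have hf := hH.measurable_stepDensity
  have hg := measurable_nonnegIndicator
  have hm : Measurable fun y => bridgeKernel (stepDensity H) nonnegIndicator n x y
      * s.indicator 1 y :=
    (measurable_bridgeKernel_right hf hg n x).mul (measurable_one.indicator hs)
  have hm' : Measurable fun y => bridgeKernel (stepDensity H) 1 n x y :=
    measurable_bridgeKernel_right hf measurable_one n x
  rw [← lintegral_mul_const _ hm]
  calc _ ≤ ∫⁻ y, bridgeKernel (stepDensity H) nonnegIndicator n x z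
        * bridgeKernel (stepDensity H) 1 n x y := lintegral_mono fun y => by
        by_cases hy : y ∈ s
        · simpa [hy] using bridgeKernel_ratio_monotone hf hH.stepDensity_totallyPositive hg
            nonnegIndicator_monotone n x (hz y hy)
        · simp [hy]
    _ = _ := by rw [lintegral_const_mul _ hm', hH.lintegral_bridgeKernel_one hZ, mul_one]

end RWAssumptions

theorem exp_le_one_add_add_sq_mul_exp_abs (u : ℝ) :
    Real.exp u ≤ 1 + u + u ^ 2 * Real.exp |u| := by
  have h := Complex.norm_exp_sub_sum_le_norm_mul_exp (u : ℂ) 2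
  have e : Complex.exp u - ∑ m ∈ Finset.range 2, (u : ℂ) ^ m / (m.factorial : ℂ)
      = ((Real.exp u - (1 + u) : ℝ) : ℂ) := by
    simp [Finset.sum_range_succ]
  rw [e, Complex.norm_real, Complex.norm_real, Real.norm_eq_abs, Real.norm_eq_abs, sq_abs] at h
  linarith [(abs_le.1 h).2]

theorem one_add_add_sq_max_le_exp (u : ℝ) : 1 + u + (max u 0) ^ 2 / 2 ≤ Real.exp u := by
  rcases le_total u 0 with hu | hu
  · rw [max_eq_right hu]
    linarith [Real.add_one_le_exp u]
  · rw [max_eq_left hu]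
    exact Real.quadratic_le_exp_of_nonneg hu

theorem exp_mul_le_of_abs_le {t₀ r t : ℝ} (ht₀ : 0 < t₀) (hr : 2 * |r| ≤ t₀) :
    Real.exp (r * t) ≤ 1 + r * t
      + r ^ 2 * (8 / t₀ ^ 2) * (Real.exp (t₀ * t) + Real.exp (-t₀ * t)) := by
  set s := t₀ / 2 * |t| with hs
  have hs0 : 0 ≤ s := by positivity
  have h1 : r ^ 2 * t ^ 2 * Real.exp |r * t| ≤ r ^ 2 * t ^ 2 * Real.exp s := by
    gcongr
    rw [abs_mul, hs]
    exact mul_le_mul_of_nonneg_right (by linarith) (abs_nonneg t)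
  have h2 : t ^ 2 ≤ 8 / t₀ ^ 2 * Real.exp s := by
    have := Real.quadratic_le_exp_of_nonneg hs0
    have h3 : t ^ 2 = 8 / t₀ ^ 2 * (s ^ 2 / 2) := by
      rw [hs, mul_pow, sq_abs]; field_simp; ring
    rw [h3]
    gcongr
    linarith
  have h3 : Real.exp s * Real.exp s ≤ Real.exp (t₀ * t) + Real.exp (-t₀ * t) := by
    rw [← Real.exp_add, hs, ← add_mul, add_halves]
    rcases abs_cases t with ⟨h, -⟩ | ⟨h, -⟩ <;> rw [h]
    · linarith [Real.exp_pos (-t₀ * t)]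
    · rw [mul_neg, ← neg_mul]
      linarith [Real.exp_pos (t₀ * t)]
  calc Real.exp (r * t) ≤ 1 + r * t + (r * t) ^ 2 * Real.exp |r * t| :=
        exp_le_one_add_add_sq_mul_exp_abs _
    _ ≤ 1 + r * t + r ^ 2 * t ^ 2 * Real.exp s := by rw [mul_pow]; linarith
    _ ≤ 1 + r * t + r ^ 2 * (8 / t₀ ^ 2 * Real.exp s) * Real.exp s := by gcongr
    _ = 1 + r * t + r ^ 2 * (8 / t₀ ^ 2) * (Real.exp s * Real.exp s) := by ring
    _ ≤ _ := by gcongr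

namespace RWAssumptions

variable {H : ℝ → ℝ} (hH : RWAssumptions H)
include hH

/-- Gaussian-type two-sided bounds on the moment generating function near zero. -/
theorem exists_mgf_bounds (hZ : ∫ x : ℝ, Real.exp (-(H x)) = 1) :
    ∃ v > 0, ∃ V > 0, ∃ r > 0, ∀ l, 0 ≤ l → l ≤ r →
      Integrable (fun t => Real.exp (l * t)) (stepLaw H) ∧
      Integrable (fun t => Real.exp (2 * l * t)) (stepLaw H) ∧
      Real.exp (v * l ^ 2) ≤ ∫ t, Real.exp (l * t) ∂(stepLaw H) ∧
      ∫ t, Real.exp (2 * l * t) ∂(stepLaw H) ≤ Real.exp (V * l ^ 2) := by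
  have := hH.isProbabilityMeasure_stepLaw hZ
  obtain ⟨t₀, ht₀, hexp⟩ := hH.exists_integrable_exp_stepLaw
  have hid := hH.integrable_id_stepLaw
  have hip : Integrable (fun t => (max t 0) ^ 2) (stepLaw H) := by
    refine (hH.integrable_pow_stepLaw 2).mono' (by fun_prop)
      (Filter.Eventually.of_forall fun t => ?_)
    rw [Real.norm_of_nonneg (sq_nonneg _)]
    rcases le_total t 0 with h | h
    · rw [max_eq_right h, zero_pow two_ne_zero]; exact sq_nonneg t
    · rw [max_eq_left h]
  set v := ∫ t, (max t 0) ^ 2 ∂(stepLaw H) with hv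
  have hv0 : 0 < v := by
    refine (integral_pos_iff_support_of_nonneg (fun t => sq_nonneg _) hip).2 ?_
    have hsup : Function.support (fun t : ℝ => (max t 0) ^ 2) = Set.Ioi 0 := by
      ext t; simp
    rw [hsup]
    exact pos_iff_ne_zero.2 (hH.stepLaw_ne_zero (by simp))
  have hi1 := hexp t₀ (abs_of_pos ht₀).le
  have hi2 := hexp (-t₀) (by rw [abs_neg, abs_of_pos ht₀])
  have hi12 : Integrable (fun t => Real.exp (t₀ * t) + Real.exp (-t₀ * t)) (stepLaw H) :=
    hi1.add hi2
  set W := ∫ t, (Real.exp (t₀ * t) + Real.exp (-t₀ * t)) ∂(stepLaw H) with hW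
  have hW0 : 0 ≤ W := integral_nonneg fun t => by positivity
  refine ⟨v / 4, by positivity, 4 * (8 / t₀ ^ 2) * W + 1, by positivity,
    min (t₀ / 4) (1 / (v + 1)), by positivity, fun l hl0 hl => ?_⟩
  have hl1 : l ≤ t₀ / 4 := hl.trans (min_le_left _ _)
  have hl2 : l * (v + 1) ≤ 1 := by
    rw [← le_div_iff₀ (by positivity)]; exact hl.trans (min_le_right _ _)
  have hil := hexp l (by rw [abs_of_nonneg hl0]; linarith)
  have hil2 := hexp (2 * l) (by rw [abs_of_nonneg (by positivity)]; linarith)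
  have hlt : ∀ r : ℝ, Integrable (fun t => 1 + r * t) (stepLaw H) := fun r =>
    (integrable_const 1).add (hid.const_mul r)
  have hlt' : ∀ r : ℝ, ∫ t, (1 + r * t) ∂(stepLaw H) = 1 := fun r => by
    rw [integral_add (integrable_const 1) (hid.const_mul r), integral_const_mul,
      hH.integral_id_stepLaw]
    simp
  refine ⟨hil, hil2, ?_, ?_⟩
  · have hip' := hip.const_mul (l ^ 2 / 2)
    have hlow : 1 + l ^ 2 / 2 * v ≤ ∫ t, Real.exp (l * t) ∂(stepLaw H) := by
      calc 1 + l ^ 2 / 2 * v = ∫ t, (1 + l * t + l ^ 2 / 2 * (max t 0) ^ 2) ∂(stepLaw H) := by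
            rw [integral_add (hlt l) hip', hlt', integral_const_mul]
        _ ≤ _ := by
            refine integral_mono ((hlt l).add hip') hil fun t => ?_
            have := one_add_add_sq_max_le_exp (l * t)
            have e : max (l * t) 0 = l * max t 0 := by
              rw [mul_max_of_nonneg _ _ hl0, mul_zero]
            rw [e] at this
            simp only
            linarith
    refine le_trans ?_ hlow
    have hy0 : 0 ≤ v / 4 * l ^ 2 := by positivity
    have hy1 : v / 4 * l ^ 2 ≤ 1 / 4 := by nlinarith
    refine (Real.exp_bound_div_one_sub_of_interval hy0 (by linarith)).trans ?_
    rw [div_le_iff₀ (by linarith)]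
    nlinarith
  · have hi' := hi12.const_mul ((2 * l) ^ 2 * (8 / t₀ ^ 2))
    have hup : ∫ t, Real.exp (2 * l * t) ∂(stepLaw H) ≤ 1 + (2 * l) ^ 2 * (8 / t₀ ^ 2) * W := by
      calc _ ≤ ∫ t, (1 + 2 * l * t + (2 * l) ^ 2 * (8 / t₀ ^ 2)
              * (Real.exp (t₀ * t) + Real.exp (-t₀ * t))) ∂(stepLaw H) := by
            refine integral_mono hil2 ((hlt _).add hi') fun t => ?_
            exact exp_mul_le_of_abs_le ht₀ (by rw [abs_of_nonneg (by positivity)]; linarith)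
        _ = _ := by rw [integral_add (hlt _) hi', hlt', integral_const_mul]
    refine hup.trans (le_trans ?_ (Real.add_one_le_exp _))
    nlinarith [sq_nonneg l]

theorem ofReal_exp_le_lintegral_Ici (hZ : ∫ x : ℝ, Real.exp (-(H x)) = 1) {l L U ε s : ℝ}
    (hi1 : Integrable (fun t => Real.exp (l * t)) (stepLaw H))
    (hi2 : Integrable (fun t => Real.exp (2 * l * t)) (stepLaw H)) (hl : 0 ≤ l)
    (hL0 : 0 ≤ L) (hL : L ≤ ∫ t, Real.exp (l * t) ∂(stepLaw H)) (hU0 : 0 ≤ U)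
    (hU : ∫ t, Real.exp (2 * l * t) ∂(stepLaw H) ≤ U) (hε : 0 ≤ ε) (n : ℕ) (x : ℝ) :
    ENNReal.ofReal (4 * ε * (L ^ (n + 1) * Real.exp (l * x) - Real.exp (l * s)
        - ε * (U ^ (n + 1) * Real.exp (2 * l * x))))
      ≤ ∫⁻ y, bridgeKernel (stepDensity H) 1 n x y * (Set.Ici s).indicator 1 y := by
  have hf := hH.measurable_stepDensity
  have := hH.isProbabilityMeasure_stepLaw hZ
  have hw : Measurable ((Set.Ici s).indicator (1 : ℝ → ℝ≥0∞)) :=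
    measurable_one.indicator measurableSet_Ici
  have step : ∀ (P Q x : ℝ), 0 ≤ P → 0 ≤ Q → ∀ F : ℝ → ℝ≥0∞,
      (∀ z, ENNReal.ofReal (4 * ε * (P * Real.exp (l * z) - Real.exp (l * s)
        - ε * (Q * Real.exp (2 * l * z)))) ≤ F z) →
      ENNReal.ofReal (4 * ε * (P * L * Real.exp (l * x) - Real.exp (l * s)
        - ε * (Q * U * Real.exp (2 * l * x)))) ≤ ∫⁻ t, F (x + t) ∂(stepLaw H) := by
    intro P Q x hP hQ F hF
    refine le_trans ?_ ((ofReal_integral_le_lintegral_ofReal _).trans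
      (lintegral_mono fun t => hF (x + t)))
    refine ENNReal.ofReal_le_ofReal ?_
    have e : ∀ t, 4 * ε * (P * Real.exp (l * (x + t)) - Real.exp (l * s)
        - ε * (Q * Real.exp (2 * l * (x + t))))
        = 4 * ε * (P * Real.exp (l * x)) * Real.exp (l * t) - 4 * ε * Real.exp (l * s)
          - 4 * ε * (ε * (Q * Real.exp (2 * l * x))) * Real.exp (2 * l * t) := fun t => by
      rw [mul_add, mul_add, Real.exp_add, Real.exp_add]; ring
    simp only [e]
    have j1 := hi1.const_mul (4 * ε * (P * Real.exp (l * x)))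
    have j2 := hi2.const_mul (4 * ε * (ε * (Q * Real.exp (2 * l * x))))
    have j3 : Integrable (fun t => 4 * ε * (P * Real.exp (l * x)) * Real.exp (l * t)
        - 4 * ε * Real.exp (l * s)) (stepLaw H) := j1.sub (integrable_const _)
    have e2 : ∫ t, 4 * ε * (ε * (Q * Real.exp (2 * l * x))) * Real.exp (2 * l * t) ∂(stepLaw H)
        = 4 * ε * (ε * (Q * Real.exp (2 * l * x))) * ∫ t, Real.exp (2 * l * t) ∂(stepLaw H) :=
      integral_const_mul _ _
    rw [integral_sub j3 j2, integral_sub j1 (integrable_const _), integral_const_mul, e2,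
      integral_const, probReal_univ, one_smul]
    have h1 := mul_le_mul_of_nonneg_left hL
      (by positivity : 0 ≤ 4 * ε * (P * Real.exp (l * x)))
    have h2 := mul_le_mul_of_nonneg_left hU
      (by positivity : 0 ≤ 4 * ε * (ε * (Q * Real.exp (2 * l * x))))
    linarith
  induction n generalizing x with
  | zero =>
    rw [lintegral_bridgeKernel_zero hf hw, ← stepLaw]
    have h := step 1 1 x zero_le_one zero_le_one ((Set.Ici s).indicator 1) fun z => by
      rcases lt_or_ge z s with hz | hz
      · refine (ENNReal.ofReal_of_nonpos ?_).trans_le zero_le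
        have h1 : Real.exp (l * z) ≤ Real.exp (l * s) :=
          Real.exp_le_exp.2 (mul_le_mul_of_nonneg_left hz.le hl)
        have h2 : 0 ≤ ε * Real.exp (2 * l * z) := by positivity
        exact mul_nonpos_of_nonneg_of_nonpos (by positivity) (by linarith)
      · rw [Set.indicator_of_mem (by exact hz), Pi.one_apply, ← ENNReal.ofReal_one]
        refine ENNReal.ofReal_le_ofReal ?_
        have h1 : Real.exp (2 * l * z) = Real.exp (l * z) ^ 2 := by
          rw [sq, ← Real.exp_add]; ring_nf
        rw [h1]
        have h2 : 0 ≤ 4 * ε * Real.exp (l * s) := by positivity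
        nlinarith [sq_nonneg (2 * ε * Real.exp (l * z) - 1)]
    simpa using h
  | succ n ih =>
    rw [lintegral_bridgeKernel_succ hf measurable_one hw, ← stepLaw]
    simp only [Pi.one_apply, one_mul]
    have h := step (L ^ (n + 1)) (U ^ (n + 1)) x (by positivity) (by positivity) _ ih
    rwa [← pow_succ, ← pow_succ] at h

theorem pow_le_lintegral_Ici (A : ℝ) (n : ℕ) {x s : ℝ} (hs : s ≤ x + (n + 1) * A) :
    stepLaw H (Set.Ici A) ^ (n + 1)
      ≤ ∫⁻ y, bridgeKernel (stepDensity H) 1 n x y * (Set.Ici s).indicator 1 y := by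
  have hf := hH.measurable_stepDensity
  have hw : Measurable ((Set.Ici s).indicator (1 : ℝ → ℝ≥0∞)) :=
    measurable_one.indicator measurableSet_Ici
  induction n generalizing x with
  | zero =>
    rw [lintegral_bridgeKernel_zero hf hw, ← stepLaw, zero_add, pow_one,
      ← lintegral_indicator_one measurableSet_Ici]
    refine lintegral_mono fun t => ?_
    by_cases ht : A ≤ t
    · have : s ≤ x + t := by simp at hs; linarith
      simp [ht, this]
    · simp [ht]
  | succ n ih =>
    rw [lintegral_bridgeKernel_succ hf measurable_one hw, ← stepLaw]
    simp only [Pi.one_apply, one_mul]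
    rw [pow_succ, ← setLIntegral_const]
    refine (setLIntegral_mono' measurableSet_Ici fun t ht => ih ?_).trans
      (setLIntegral_le_lintegral _ _)
    have : A ≤ t := ht
    push_cast at hs
    linarith

/-- The walk exceeds any fixed multiple of the diffusive scale with positive probability,
uniformly in the number of steps. -/
theorem exists_le_lintegral_Ici (hZ : ∫ x : ℝ, Real.exp (-(H x)) = 1) {K : ℝ} (hK : 0 ≤ K) :
    ∃ c > 0, ∀ (n : ℕ) (x s : ℝ), s ≤ x + K * √(n + 1) →
      ENNReal.ofReal c
        ≤ ∫⁻ y, bridgeKernel (stepDensity H) 1 n x y * (Set.Ici s).indicator 1 y := by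
  have := hH.isProbabilityMeasure_stepLaw hZ
  obtain ⟨v, hv, V, hV, r, hr, hb⟩ := hH.exists_mgf_bounds hZ
  set a := (K + 1) / v with ha
  have ha0 : 0 < a := by positivity
  set B := Real.exp (V * a ^ 2) with hB
  obtain ⟨n₀, hn₀⟩ := exists_nat_ge ((a / r) ^ 2)
  set A := K * √n₀ with hA
  set p := (stepLaw H).real (Set.Ici A) with hp
  have hp0 : 0 < p := by
    rw [hp, measureReal_def]
    exact ENNReal.toReal_pos (hH.stepLaw_ne_zero (by simp)) (measure_ne_top _ _)
  have hp1 : p ≤ 1 := measureReal_le_one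
  refine ⟨min (a ^ 2 / B) (p ^ n₀), by positivity, fun n x s hs => ?_⟩
  rcases le_or_gt n₀ n with hn | hn
  · have hn1 : (0 : ℝ) < n + 1 := by positivity
    have hsq : 0 < √((n : ℝ) + 1) := Real.sqrt_pos.2 hn1
    set l := a / √((n : ℝ) + 1) with hl
    have hl0 : 0 ≤ l := by positivity
    have hlr : l ≤ r := by
      rw [hl, div_le_iff₀ hsq, ← div_le_iff₀' hr]
      refine Real.le_sqrt_of_sq_le (hn₀.trans ?_)
      have : (n₀ : ℝ) ≤ n := by exact_mod_cast hn
      linarith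
    have hl2 : ((n + 1 : ℕ) : ℝ) * l ^ 2 = a ^ 2 := by
      rw [hl, div_pow, Real.sq_sqrt hn1.le]; push_cast; field_simp
    obtain ⟨hi1, hi2, hL, hU⟩ := hb l hl0 hlr
    refine le_trans (ENNReal.ofReal_le_ofReal ((min_le_left _ _).trans ?_))
      (hH.ofReal_exp_le_lintegral_Ici hZ (s := s)
        (ε := a / (2 * B) * Real.exp (-(l * x))) hi1 hi2 hl0
        (Real.exp_pos _).le hL (Real.exp_pos _).le hU (by positivity) n x)
    have hLn : Real.exp (v * l ^ 2) ^ (n + 1) = Real.exp (a * (K + 1)) := by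
      rw [← Real.exp_nat_mul, mul_left_comm, hl2, ha]; congr 1; field_simp
    have hUn : Real.exp (V * l ^ 2) ^ (n + 1) = B := by
      rw [← Real.exp_nat_mul, mul_left_comm, hl2]
    rw [hLn, hUn]
    set E := Real.exp (l * x) with hE
    have hE0 : 0 < E := Real.exp_pos _
    have hE1 : Real.exp (-(l * x)) = E⁻¹ := Real.exp_neg _
    have hE2 : Real.exp (2 * l * x) = E ^ 2 := by rw [sq, ← Real.exp_add]; ring_nf
    have hs' : Real.exp (l * s) ≤ E * Real.exp (a * K) := by
      rw [hE, ← Real.exp_add]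
      refine Real.exp_le_exp.2 ((mul_le_mul_of_nonneg_left hs hl0).trans_eq ?_)
      rw [hl]; field_simp
    have hgap : a ≤ Real.exp (a * (K + 1)) - Real.exp (a * K) := by
      have h1 : Real.exp (a * (K + 1)) = Real.exp (a * K) * Real.exp a := by
        rw [← Real.exp_add]; ring_nf
      have h2 : 1 ≤ Real.exp (a * K) := Real.one_le_exp (by positivity)
      have h3 := Real.add_one_le_exp a
      rw [h1]
      nlinarith
    have hB0 : 0 < B := Real.exp_pos _
    rw [hE1, hE2]
    calc a ^ 2 / B = 4 * (a / (2 * B) * E⁻¹) * (a * E - a / (2 * B) * E⁻¹ * (B * E ^ 2)) := by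
          field_simp; ring
      _ ≤ _ := by
          refine mul_le_mul_of_nonneg_left ?_ (by positivity)
          nlinarith
  · have hA0 : 0 ≤ A := by positivity
    have hn' : (n : ℝ) + 1 ≤ n₀ := by exact_mod_cast hn
    refine le_trans (ENNReal.ofReal_le_ofReal ((min_le_right _ _).trans
      (pow_le_pow_of_le_one hp0.le hp1 hn))) ?_
    rw [ENNReal.ofReal_pow hp0.le, hp, measureReal_def, ENNReal.ofReal_toReal (measure_ne_top _ _)]
    refine hH.pow_le_lintegral_Ici A n (hs.trans ?_)
    have h1 : K * √((n : ℝ) + 1) ≤ A :=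
      mul_le_mul_of_nonneg_left (Real.sqrt_le_sqrt hn') hK
    have h2 : 0 ≤ (n : ℝ) * A := by positivity
    linarith

end RWAssumptions

theorem integral_exp_reflect {H : ℝ → ℝ} (hZ : ∫ x : ℝ, Real.exp (-(H x)) = 1) :
    ∫ x : ℝ, Real.exp (-(H (-x))) = 1 :=
  (integral_neg_eq_self (fun t => Real.exp (-(H t))) volume).trans hZ

namespace RWAssumptions

variable {H : ℝ → ℝ} (hH : RWAssumptions H)
include hH

theorem exists_bridgeKernel_ge_of_le (hZ : ∫ x : ℝ, Real.exp (-(H x)) = 1) {M : ℝ} (hM : 0 < M) :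
    ∃ c > 0, ∃ K₀ : ℝ, ∀ K, K₀ ≤ K → ∀ n N : ℕ, n + 1 ≤ N → ∀ x ∈ Set.Icc 0 (M * √N),
      ∀ z, K * √N ≤ z → ENNReal.ofReal (c * (x + 1) / √N) * bridgeKernel (stepDensity H) 1 n x z
        ≤ bridgeKernel (stepDensity H) nonnegIndicator n x z := by
  obtain ⟨c, hc, K₀, h⟩ := hH.exists_le_survival_near hZ hM
  refine ⟨c, hc, K₀, fun K hK n N hnN x hx z hz => ?_⟩
  exact (mul_le_mul' (h K hK n N hnN x hx) le_rfl).trans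
    (hH.lintegral_mul_bridgeKernel_le hZ n x measurableSet_Icc fun w hw => hw.2.trans hz)

theorem exists_bridgeKernel_ge_of_le' (hZ : ∫ x : ℝ, Real.exp (-(H x)) = 1) {M : ℝ}
    (hM : 0 < M) :
    ∃ c > 0, ∃ K₀ : ℝ, ∀ K, K₀ ≤ K → ∀ n N : ℕ, n + 1 ≤ N → ∀ y ∈ Set.Icc 0 (M * √N),
      ∀ z, K * √N ≤ z → ENNReal.ofReal (c * (y + 1) / √N) * bridgeKernel (stepDensity H) 1 n z y
        ≤ bridgeKernel (stepDensity H) nonnegIndicator n z y := by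
  obtain ⟨c, hc, K₀, h⟩ := hH.reflect.exists_bridgeKernel_ge_of_le (integral_exp_reflect hZ) hM
  refine ⟨c, hc, K₀, fun K hK n N hnN y hy z hz => ?_⟩
  have := h K hK n N hnN y hy z hz
  rw [← bridgeKernel_reverse hH.measurable_stepDensity measurable_one,
    ← bridgeKernel_reverse hH.measurable_stepDensity measurable_nonnegIndicator]
  exact this

theorem exists_le_lintegral_Iic (hZ : ∫ x : ℝ, Real.exp (-(H x)) = 1) {K : ℝ} (hK : 0 ≤ K) :
    ∃ c > 0, ∀ (n : ℕ) (z y : ℝ), z ≤ y + K * √(n + 1) →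
      ENNReal.ofReal c
        ≤ ∫⁻ w, bridgeKernel (stepDensity H) 1 n z w * (Set.Iic y).indicator 1 w := by
  obtain ⟨c, hc, h⟩ := hH.reflect.exists_le_lintegral_Ici (integral_exp_reflect hZ) hK
  refine ⟨c, hc, fun n z y hzy => (h n (-z) (-y) (by linarith)).trans_eq ?_⟩
  rw [← lintegral_neg_eq_self]
  refine lintegral_congr fun w => ?_
  congr 1
  · exact bridgeKernel_neg (f := stepDensity H) (g := 1) n z w
  · by_cases hw : w ≤ y <;> simp [hw]

theorem lintegral_bridgeKernel_sq_le (hZ : ∫ x : ℝ, Real.exp (-(H x)) = 1) (n : ℕ) (x : ℝ) :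
    ∫⁻ y, bridgeKernel (stepDensity H) 1 n x y * ENNReal.ofReal (y ^ 2)
      ≤ ENNReal.ofReal (x ^ 2 + (n + 1) * ∫ t, t ^ 2 ∂(stepLaw H)) := by
  have hf := hH.measurable_stepDensity
  have := hH.isProbabilityMeasure_stepLaw hZ
  have hw : Measurable fun y : ℝ => ENNReal.ofReal (y ^ 2) := by fun_prop
  set σ := ∫ t, t ^ 2 ∂(stepLaw H) with hσ
  have hσ0 : 0 ≤ σ := integral_nonneg fun t => by positivity
  have step : ∀ (k x : ℝ), 0 ≤ k → ∫⁻ t, ENNReal.ofReal ((x + t) ^ 2 + k * σ) ∂(stepLaw H)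
      = ENNReal.ofReal (x ^ 2 + (k + 1) * σ) := by
    intro k x hk
    obtain ⟨hi, he⟩ := hH.integral_cubic_stepLaw hZ (x ^ 2 + k * σ) (2 * x) 1 0 0
    have e : ∀ t, (x + t) ^ 2 + k * σ
        = x ^ 2 + k * σ + 2 * x * t + 1 * t ^ 2 + 0 * t ^ 3 + 0 * |t| ^ 3 := fun t => by ring
    have hnn : ∀ t, 0 ≤ x ^ 2 + k * σ + 2 * x * t + 1 * t ^ 2 + 0 * t ^ 3 + 0 * |t| ^ 3 :=
      fun t => by rw [← e]; positivity
    simp only [e]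
    rw [← ofReal_integral_eq_lintegral_ofReal hi (Filter.Eventually.of_forall hnn), he, ← hσ]
    congr 1; ring
  induction n generalizing x with
  | zero =>
    rw [lintegral_bridgeKernel_zero hf hw, ← stepLaw]
    have h := step 0 x le_rfl
    simp only [zero_mul, add_zero] at h
    simp [h]
  | succ n ih =>
    rw [lintegral_bridgeKernel_succ hf measurable_one hw, ← stepLaw]
    simp only [Pi.one_apply, one_mul]
    refine (lintegral_mono fun t => ih (x + t)).trans_eq ?_
    rw [step _ _ (by positivity)]
    push_cast
    rfl

theorem exists_le_lintegral_Icc (hZ : ∫ x : ℝ, Real.exp (-(H x)) = 1) {M K : ℝ} (hM : 0 < M)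
    (hK : 0 ≤ K) :
    ∃ c > 0, ∃ K' ≥ 0, ∀ n N : ℕ, n + 1 ≤ N → N ≤ 4 * (n + 1) → ∀ x ∈ Set.Icc 0 (M * √N),
      ENNReal.ofReal c ≤ ∫⁻ y, bridgeKernel (stepDensity H) 1 n x y
        * (Set.Icc (K * √N) (K' * √N)).indicator 1 y := by
  have hf := hH.measurable_stepDensity
  obtain ⟨c, hc, h⟩ := hH.exists_le_lintegral_Ici hZ (K := 2 * K) (by positivity)
  set σ := ∫ t, t ^ 2 ∂(stepLaw H) with hσ
  have hσ0 : 0 ≤ σ := integral_nonneg fun t => by positivity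
  set D := 2 * (M ^ 2 + σ) / c with hD
  have hD0 : 0 ≤ D := by positivity
  refine ⟨c / 2, by positivity, D + 1, by positivity, fun n N hnN hNn x hx => ?_⟩
  have hN : (0 : ℝ) < N := by exact_mod_cast (Nat.succ_pos n).trans_le hnN
  have hnN' : (n : ℝ) + 1 ≤ N := by exact_mod_cast hnN
  have hNn' : (N : ℝ) ≤ 4 * (n + 1) := by exact_mod_cast hNn
  have hN0 : 0 < √(N : ℝ) := Real.sqrt_pos.2 hN
  have hsq : √(N : ℝ) ≤ 2 * √((n : ℝ) + 1) := by
    rw [Real.sqrt_le_left (by positivity), mul_pow, Real.sq_sqrt (by positivity)]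
    linarith
  set k := bridgeKernel (stepDensity H) 1 n x with hk
  have hkm : Measurable k := measurable_bridgeKernel_right hf measurable_one n x
  set κ := (D + 1) * √N with hκ
  have hκ0 : 0 < κ := by positivity
  have hfar : ∫⁻ y, k y * (Set.Ioi κ).indicator 1 y ≤ ENNReal.ofReal (c / 2) := by
    have h1 : (∫⁻ y, k y * (Set.Ioi κ).indicator 1 y) * ENNReal.ofReal (κ ^ 2)
        ≤ ENNReal.ofReal (x ^ 2 + (n + 1) * σ) := by
      rw [← lintegral_mul_const' _ _ ENNReal.ofReal_ne_top]
      refine (lintegral_mono fun y => ?_).trans (hH.lintegral_bridgeKernel_sq_le hZ n x)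
      rcases le_or_gt y κ with hy | hy
      · simp [hy]
      · rw [Set.indicator_of_mem (by exact hy), Pi.one_apply, mul_one]
        exact mul_le_mul' le_rfl (ENNReal.ofReal_le_ofReal
          (pow_le_pow_left₀ hκ0.le hy.le 2))
    refine (ENNReal.le_div_iff_mul_le (Or.inl (by simpa using hκ0.ne'))
      (Or.inl ENNReal.ofReal_ne_top)).2 h1 |>.trans ?_
    rw [← ENNReal.ofReal_div_of_pos (by positivity)]
    refine ENNReal.ofReal_le_ofReal ?_
    rw [div_le_iff₀ (by positivity), hκ, mul_pow, Real.sq_sqrt hN.le]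
    have hx2 : x ^ 2 ≤ M ^ 2 * N := by
      rw [← Real.sq_sqrt hN.le, ← mul_pow]
      exact pow_le_pow_left₀ hx.1 hx.2 2
    have h2 := mul_le_mul_of_nonneg_right hnN' hσ0
    have h3 : c * D = 2 * (M ^ 2 + σ) := by rw [hD]; field_simp
    have h4 : c / 2 * ((D + 1) ^ 2 * N) = (c * D) / 2 * N + c / 2 * (D ^ 2 + D + 1) * N := by ring
    have h5 : 0 ≤ c / 2 * (D ^ 2 + D + 1) * N := by positivity
    rw [h4, h3]
    linarith
  have hsplit : ∫⁻ y, k y * (Set.Ici (K * √N)).indicator 1 y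
      ≤ (∫⁻ y, k y * (Set.Icc (K * √N) κ).indicator 1 y)
        + ∫⁻ y, k y * (Set.Ioi κ).indicator 1 y := by
    have hkI : Measurable fun y => k y * (Set.Icc (K * √N) κ).indicator 1 y :=
      hkm.mul (measurable_one.indicator measurableSet_Icc)
    rw [← lintegral_add_left hkI]
    refine lintegral_mono fun y => ?_
    rw [← mul_add]
    refine mul_le_mul' le_rfl ?_
    rcases lt_or_ge y (K * √N) with h0 | h0
    · simp [h0]
    · rcases le_or_gt y κ with hy | hy
      · simp [h0, hy]
      · simp [h0, hy]
  have hs : K * √N ≤ x + 2 * K * √((n : ℝ) + 1) := by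
    have := mul_le_mul_of_nonneg_left hsq hK
    linarith [hx.1]
  have htot := ((h n x (K * √N) hs).trans hsplit).trans (add_le_add le_rfl hfar)
  have hadd : ENNReal.ofReal c = ENNReal.ofReal (c / 2) + ENNReal.ofReal (c / 2) := by
    rw [← ENNReal.ofReal_add (by positivity) (by positivity), add_halves]
  rw [hadd] at htot
  exact (ENNReal.add_le_add_iff_right ENNReal.ofReal_ne_top).1 htot

/-- Conditioning the bridge to end lower makes it less likely to be high at an intermediate
time. -/
theorem lintegral_Ici_mul_bridgeKernel_le (a b : ℕ) (x κ : ℝ) {w y : ℝ} (hwy : w ≤ y) :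
    bridgeKernel (stepDensity H) 1 (a + b + 1) x y
        * (∫⁻ z, bridgeKernel (stepDensity H) 1 a x z * bridgeKernel (stepDensity H) 1 b z w
          * (Set.Ici κ).indicator 1 z)
      ≤ (∫⁻ z, bridgeKernel (stepDensity H) 1 a x z * bridgeKernel (stepDensity H) 1 b z y
          * (Set.Ici κ).indicator 1 z)
        * bridgeKernel (stepDensity H) 1 (a + b + 1) x w := by
  have hf := hH.measurable_stepDensity
  have hm : ∀ y, Measurable fun z =>
      bridgeKernel (stepDensity H) 1 a x z * bridgeKernel (stepDensity H) 1 b z y := fun y =>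
    (measurable_bridgeKernel_right hf measurable_one a x).mul
      (measurable_bridgeKernel_left hf measurable_one b y)
  have h := lintegral_mul_lintegral_le_of_likelihoodRatio (μ := volume) (hm y) (hm w)
    (φ := (Set.Ici κ).indicator 1) (ψ := 1) (measurable_one.indicator measurableSet_Ici)
    measurable_one
    (fun z z' hz => by
      have := bridgeKernel_one_totallyPositive hf hH.stepDensity_totallyPositive b hz hwy
      calc _ = bridgeKernel (stepDensity H) 1 a x z * bridgeKernel (stepDensity H) 1 a x z'
            * (bridgeKernel (stepDensity H) 1 b z y * bridgeKernel (stepDensity H) 1 b z' w) := by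
            ring
        _ ≤ bridgeKernel (stepDensity H) 1 a x z * bridgeKernel (stepDensity H) 1 a x z'
            * (bridgeKernel (stepDensity H) 1 b z' y * bridgeKernel (stepDensity H) 1 b z w) :=
            mul_le_mul' le_rfl this
        _ = _ := by ring)
    (fun z z' hz => by
      by_cases h : κ ≤ z
      · simp [h, h.trans hz]
      · simp [h])
  have e : ∀ y, bridgeKernel (stepDensity H) 1 (a + b + 1) x y
      = ∫⁻ z, bridgeKernel (stepDensity H) 1 a x z * bridgeKernel (stepDensity H) 1 b z y
        * (1 : ℝ → ℝ≥0∞) z := fun y => by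
    rw [bridgeKernel_add hf measurable_one]
    simp
  rw [e, e]
  exact h

theorem exists_mul_bridgeKernel_le_lintegral_Ici (hZ : ∫ x : ℝ, Real.exp (-(H x)) = 1)
    {M K : ℝ} (hM : 0 < M) (hK : 0 ≤ K) :
    ∃ c > 0, ∀ a b N : ℕ, a + 1 ≤ N → N ≤ 4 * (a + 1) → N ≤ 4 * (b + 1) →
      ∀ x ∈ Set.Icc 0 (M * √N), ∀ y, 0 ≤ y →
      ENNReal.ofReal c * bridgeKernel (stepDensity H) 1 (a + b + 1) x y
        ≤ ∫⁻ z, bridgeKernel (stepDensity H) 1 a x z * bridgeKernel (stepDensity H) 1 b z y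
          * (Set.Ici (K * √N)).indicator 1 z := by
  have hf := hH.measurable_stepDensity
  obtain ⟨c₁, hc₁, K', hK', h₁⟩ := hH.exists_le_lintegral_Icc hZ hM hK
  obtain ⟨c₂, hc₂, h₂⟩ := hH.exists_le_lintegral_Iic hZ (K := 2 * K') (by positivity)
  refine ⟨c₁ * c₂, by positivity, fun a b N haN hNa hNb x hx y hy => ?_⟩
  have hNb' : (N : ℝ) ≤ 4 * (b + 1) := by exact_mod_cast hNb
  have hsq : √(N : ℝ) ≤ 2 * √((b : ℝ) + 1) := by
    rw [Real.sqrt_le_left (by positivity), mul_pow, Real.sq_sqrt (by positivity)]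
    linarith
  set κ := K * √N with hκ
  set Q := bridgeKernel (stepDensity H) 1 with hQ
  have hQm : ∀ n, Measurable fun p : ℝ × ℝ => Q n p.1 p.2 :=
    measurable_bridgeKernel hf measurable_one
  set I : ℝ → ℝ≥0∞ := fun w => ∫⁻ z, Q a x z * Q b z w * (Set.Ici κ).indicator 1 z with hI
  have hind : Measurable ((Set.Ici κ).indicator (1 : ℝ → ℝ≥0∞)) :=
    measurable_one.indicator measurableSet_Ici
  have hiic : Measurable ((Set.Iic y).indicator (1 : ℝ → ℝ≥0∞)) :=
    measurable_one.indicator measurableSet_Iic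
  have hax : Measurable fun z => Q a x z := measurable_bridgeKernel_right hf measurable_one a x
  have hjoint : Measurable fun p : ℝ × ℝ => Q a x p.2 * Q b p.2 p.1 * (Set.Ici κ).indicator 1 p.2 :=
    ((hax.comp measurable_snd).mul ((hQm b).comp measurable_swap)).mul (hind.comp measurable_snd)
  have hIm : Measurable I := hjoint.lintegral_prod_right'
  have hIm' : Measurable fun w => I w * (Set.Iic y).indicator 1 w := hIm.mul hiic
  have hupper : Q (a + b + 1) x y * ∫⁻ w, I w * (Set.Iic y).indicator 1 w ≤ I y := by
    rw [← lintegral_const_mul _ hIm']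
    calc _ ≤ ∫⁻ w, I y * Q (a + b + 1) x w := lintegral_mono fun w => by
          by_cases hw : w ≤ y
          · simpa [hw] using hH.lintegral_Ici_mul_bridgeKernel_le a b x κ hw
          · simp [hw]
      _ = I y := by
          have : Measurable fun w => Q (a + b + 1) x w :=
            measurable_bridgeKernel_right hf measurable_one _ x
          rw [lintegral_const_mul _ this, hH.lintegral_bridgeKernel_one hZ, mul_one]
  have hlower : ENNReal.ofReal (c₁ * c₂) ≤ ∫⁻ w, I w * (Set.Iic y).indicator 1 w := by
    have hswap : ∫⁻ w, I w * (Set.Iic y).indicator 1 w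
        = ∫⁻ z, Q a x z * (Set.Ici κ).indicator 1 z
          * (∫⁻ w, Q b z w * (Set.Iic y).indicator 1 w) := by
      calc _ = ∫⁻ w, ∫⁻ z, Q a x z * Q b z w * (Set.Ici κ).indicator 1 z
            * (Set.Iic y).indicator 1 w := by
            refine lintegral_congr fun w => ?_
            have : Measurable fun z => Q a x z * Q b z w * (Set.Ici κ).indicator 1 z :=
              hjoint.comp (measurable_const.prodMk measurable_id)
            rw [← lintegral_mul_const _ this]
        _ = ∫⁻ z, ∫⁻ w, Q a x z * Q b z w * (Set.Ici κ).indicator 1 z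
            * (Set.Iic y).indicator 1 w :=
            lintegral_lintegral_swap (hjoint.mul (hiic.comp measurable_fst)).aemeasurable
        _ = _ := by
            refine lintegral_congr fun z => ?_
            have : Measurable fun w => Q b z w * (Set.Iic y).indicator 1 w :=
              (measurable_bridgeKernel_right hf measurable_one b z).mul hiic
            rw [← lintegral_const_mul _ this]
            refine lintegral_congr fun w => ?_
            ring
    rw [hswap, ENNReal.ofReal_mul hc₁.le]
    refine (mul_le_mul' (h₁ a N haN hNa x hx) le_rfl).trans ?_
    have : Measurable fun z => Q a x z * (Set.Icc κ (K' * √N)).indicator 1 z :=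
      hax.mul (measurable_one.indicator measurableSet_Icc)
    rw [← lintegral_mul_const _ this]
    refine lintegral_mono fun z => ?_
    by_cases hz : z ∈ Set.Icc κ (K' * √N)
    · have hz1 : z ∈ Set.Ici κ := hz.1
      rw [Set.indicator_of_mem hz, Set.indicator_of_mem hz1]
      refine mul_le_mul' le_rfl (h₂ b z y ?_)
      have := mul_le_mul_of_nonneg_left hsq hK'
      linarith [hz.2]
    · simp [hz]
  rw [mul_comm]
  exact (mul_le_mul' le_rfl hlower).trans hupper

theorem exists_bridgeKernel_ballot (hZ : ∫ x : ℝ, Real.exp (-(H x)) = 1) {M : ℝ} (hM : 0 < M) :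
    ∃ c > 0, ∀ N : ℕ, 1 ≤ N → ∀ x ∈ Set.Icc 0 (M * √N), ∀ y ∈ Set.Icc 0 (M * √N),
      ENNReal.ofReal (c * min 1 (x * y / N)) * bridgeKernel (stepDensity H) 1 (N - 1) x y
        ≤ bridgeKernel (stepDensity H) nonnegIndicator (N - 1) x y := by
  have hf := hH.measurable_stepDensity
  have hg := measurable_nonnegIndicator
  obtain ⟨c₁, hc₁, K₁, h₁⟩ := hH.exists_bridgeKernel_ge_of_le hZ hM
  obtain ⟨c₂, hc₂, K₂, h₂⟩ := hH.exists_bridgeKernel_ge_of_le' hZ hM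
  set K := max 0 (max K₁ K₂) with hK
  have hK0 : 0 ≤ K := le_max_left _ _
  have hK1 : K₁ ≤ K := (le_max_left _ _).trans (le_max_right _ _)
  have hK2 : K₂ ≤ K := (le_max_right _ _).trans (le_max_right _ _)
  obtain ⟨c₃, hc₃, h₃⟩ := hH.exists_mul_bridgeKernel_le_lintegral_Ici hZ hM hK0
  refine ⟨min 1 (c₁ * c₂ * c₃), by positivity, fun N hN x hx y hy => ?_⟩
  have hx0 := hx.1
  have hy0 := hy.1
  rcases hN.eq_or_lt with rfl | hN
  · refine mul_le_of_le_one_left' ?_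
    rw [ENNReal.ofReal_le_one]
    exact mul_le_one₀ (min_le_left _ _) (by positivity) (min_le_left _ _)
  obtain ⟨a, b, hab, haN, hbN, hNa, hNb⟩ : ∃ a b : ℕ, N - 1 = a + b + 1 ∧ a + 1 ≤ N ∧ b + 1 ≤ N ∧
      N ≤ 4 * (a + 1) ∧ N ≤ 4 * (b + 1) :=
    ⟨(N - 2) / 2, N - 2 - (N - 2) / 2, by omega, by omega, by omega, by omega, by omega⟩
  have hN0 : (0 : ℝ) < N := by exact_mod_cast (Nat.zero_lt_one.trans hN)
  have hsN : 0 < √(N : ℝ) := Real.sqrt_pos.2 hN0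
  rw [hab]
  set r₁ := c₁ * (x + 1) / √N with hr₁
  set r₂ := c₂ * (y + 1) / √N with hr₂
  have hr₁0 : 0 ≤ r₁ := by positivity
  have hr₂0 : 0 ≤ r₂ := by positivity
  have hr : min 1 (c₁ * c₂ * c₃) * min 1 (x * y / N) ≤ r₁ * r₂ * c₃ := by
    calc min 1 (c₁ * c₂ * c₃) * min 1 (x * y / N) ≤ (c₁ * c₂ * c₃) * (x * y / N) :=
          mul_le_mul (min_le_right _ _) (min_le_right _ _) (by positivity) (by positivity)
      _ ≤ (c₁ * c₂ * c₃) * ((x + 1) * (y + 1) / N) := by gcongr <;> linarith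
      _ = _ := by
          rw [hr₁, hr₂]
          nth_rewrite 1 [← Real.mul_self_sqrt hN0.le]
          field_simp
  calc ENNReal.ofReal (min 1 (c₁ * c₂ * c₃) * min 1 (x * y / N))
        * bridgeKernel (stepDensity H) 1 (a + b + 1) x y
      ≤ ENNReal.ofReal (r₁ * r₂) * (ENNReal.ofReal c₃
        * bridgeKernel (stepDensity H) 1 (a + b + 1) x y) := by
        rw [← mul_assoc, ← ENNReal.ofReal_mul (by positivity)]
        exact mul_le_mul' (ENNReal.ofReal_le_ofReal hr) le_rfl
    _ ≤ ENNReal.ofReal (r₁ * r₂) * _ := mul_le_mul' le_rfl (h₃ a b N haN hNa hNb x hx y hy0)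
    _ ≤ ∫⁻ z, bridgeKernel (stepDensity H) nonnegIndicator a x z
        * (nonnegIndicator z * bridgeKernel (stepDensity H) nonnegIndicator b z y) := by
        rw [← lintegral_const_mul' _ _ ENNReal.ofReal_ne_top]
        refine lintegral_mono fun z => ?_
        by_cases hz : K * √N ≤ z
        · rw [Set.indicator_of_mem (by exact hz), Pi.one_apply, mul_one,
            nonnegIndicator_of_nonneg (le_trans (by positivity) hz), one_mul,
            ENNReal.ofReal_mul hr₁0, mul_mul_mul_comm]
          exact mul_le_mul' (h₁ K hK1 a N haN x hx z hz) (h₂ K hK2 b N hbN y hy z hz)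
        · simp [hz]
    _ = _ := (bridgeKernel_add hf hg a b x y).symm

end RWAssumptions

/-- Ballot lower bound in the diffusive regime: fix `M > 0`. There exists `c > 0`
such that for all `N ≥ 1` and `x, y ∈ [0, M√N]`, the random walk bridge from `x`
to `y` on `⟦0,N⟧` stays nonnegative at times `1, …, N-1` with probability at
least `c·min(1, xy/N)`. -/
theorem ballot_lower_diffusive (H : ℝ → ℝ) (hH : RWAssumptions H)
    (M : ℝ) (hM : 0 < M) :
    ∃ c > 0, ∀ N : ℕ, 1 ≤ N → ∀ x y : ℝ,
      x ∈ Set.Icc 0 (M * Real.sqrt N) → y ∈ Set.Icc 0 (M * Real.sqrt N) →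
      ENNReal.ofReal (c * min 1 (x * y / N))
        ≤ probOf (bridgeMeasure H x y (N - 1))
            {q | ∀ k, 1 ≤ k → k ≤ N - 1 → 0 ≤ pathOf x y (N - 1) q k} := by
  set Z := ∫ x : ℝ, Real.exp (-(H x)) with hZdef
  have hZ0 : 0 < Z := hH.norm_pos
  have hH' := hH.add_const (Real.log Z)
  have hZ : ∫ x : ℝ, Real.exp (-(H x + Real.log Z)) = 1 := by
    have e : ∀ x, Real.exp (-(H x + Real.log Z)) = Real.exp (-(H x)) * Z⁻¹ := fun x => by
      rw [neg_add, Real.exp_add, Real.exp_neg (Real.log Z), Real.exp_log hZ0]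
    simp only [e]
    rw [integral_mul_const, ← hZdef, mul_inv_cancel₀ hZ0.ne']
  obtain ⟨c, hc, h⟩ := hH'.exists_bridgeKernel_ballot hZ hM
  refine ⟨c, hc, fun N hN x y hx hy => ?_⟩
  obtain ⟨B, hB⟩ := hH'.exists_stepDensity_le
  have hfin : bridgeKernel (stepDensity fun t => H t + Real.log Z) 1 (N - 1) x y ≠ ∞ :=
    ((bridgeKernel_one_le (hH'.lintegral_stepDensity hZ) hB hH'.measurable_stepDensity
      _ _ _).trans_lt ENNReal.ofReal_lt_top).ne
  have hpos := (bridgeKernel_one_pos hH'.measurable_stepDensity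
    (RWAssumptions.stepDensity_pos _) (N - 1) x y).ne'
  have hscale0 : ENNReal.ofReal (Real.exp (-(Real.log Z))) ^ (N - 1 + 1) ≠ 0 :=
    pow_ne_zero _ (by simpa using Real.exp_pos _)
  have hscale : ENNReal.ofReal (Real.exp (-(Real.log Z))) ^ (N - 1 + 1) ≠ ∞ :=
    ENNReal.pow_ne_top ENNReal.ofReal_ne_top
  rw [probOf, bridgeMeasure_univ hH.measurable, bridgeMeasure_nonneg hH.measurable,
    ← ENNReal.mul_div_mul_left _ _ hscale0 hscale,
    ← bridgeKernel_stepDensity_add_const hH.measurable measurable_nonnegIndicator,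
    ← bridgeKernel_stepDensity_add_const hH.measurable measurable_one,
    ENNReal.le_div_iff_mul_le (Or.inl hpos) (Or.inl hfin)]
  exact h N hN x hx y hy
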